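/- arXiv:1602.02264 — 2 statements merged into one kernel-verified Lean document; each statement's English description precedes it below -/
import Mathlib

section
/- Let d ≥ 2 and n ≥ 1 be integers, and let X be a set of (d+1)n points in general position in ℝ^d partitioned into d color classes, each containing at least n points. Then X spans n pairwise disjoint d-colorful (d+1)-islands; that is, there exist subsets Y₁, …, Yₙ of X such that each Yᵢ has exactly d+1 points, each Yᵢ contains a point of every one of the d color classes, X ∩ conv(Yᵢ) = Yᵢ for every i, and the convex hulls conv(Y₁), …, conv(Yₙ) are pairwise disjoint. -/
noncomputable instance (d : ℕ) : DecidableEq (EuclideanSpace ℝ (Fin d)) := Classical.decEq _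

/-- A finite point set in `ℝ^d` is in general position if every subset
of size at most `d + 1` is affinely independent. -/
def GenPos (d : ℕ) (X : Finset (EuclideanSpace ℝ (Fin d))) : Prop :=
  ∀ S : Finset (EuclideanSpace ℝ (Fin d)), S ⊆ X → S.card ≤ d + 1 →
    AffineIndependent ℝ (fun p : S => (p : EuclideanSpace ℝ (Fin d)))


/-- A linear pencil `A + s K` on a filtered space is bijective off a countable set of `s`. -/
lemma pencil_bijective {V : Type*} [AddCommGroup V] [Module ℝ V] (F : ℕ → Submodule ℝ V)
    (hfin : ∀ m, FiniteDimensional ℝ (F m)) (hcov : ∀ v, ∃ m, v ∈ F m)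
    (A K : V →ₗ[ℝ] V) (hA : ∀ m, ∀ v ∈ F m, A v ∈ F m) (hK : ∀ m, ∀ v ∈ F m, K v ∈ F m)
    (hsurj : ∀ m, ∀ v ∈ F m, ∃ u ∈ F m, A u = v) :
    ∃ bad : Set ℝ, bad.Countable ∧ ∀ s, s ∉ bad → Function.Bijective (A + s • K) := by
  have key : ∀ m, ∃ bad : Set ℝ, bad.Countable ∧ ∀ s, s ∉ bad →
      Function.Bijective ((A.restrict (hA m)) + s • (K.restrict (hK m))) := by
    intro m
    have := hfin m
    have hs : Function.Surjective (A.restrict (hA m)) := by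
      rintro ⟨v, hv⟩
      obtain ⟨u, hu, huv⟩ := hsurj m v hv
      exact ⟨⟨u, hu⟩, Subtype.ext huv⟩
    have hi : Function.Injective (A.restrict (hA m)) := LinearMap.injective_iff_surjective.2 hs
    let e := LinearEquiv.ofBijective (A.restrict (hA m)) ⟨hi, hs⟩
    let T : Module.End ℝ (F m) := e.symm.toLinearMap ∘ₗ (K.restrict (hK m))
    refine ⟨(fun μ : ℝ => -μ⁻¹) '' {μ | T.HasEigenvalue μ}, ?_, ?_⟩
    · exact ((Module.End.finite_hasEigenvalue T).image _).countable
    · intro s hsb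
      have hinj : Function.Injective ((A.restrict (hA m)) + s • (K.restrict (hK m))) := by
        rw [injective_iff_map_eq_zero]
        intro v hv
        by_contra hv0
        have h1 : e v + s • (K.restrict (hK m)) v = 0 := hv
        have h2 : v + s • T v = 0 := by
          have := congrArg e.symm h1
          simpa [T] using this
        have hs0 : s ≠ 0 := by
          rintro rfl
          simp at h2
          exact hv0 h2
        apply hsb
        refine ⟨-s⁻¹, ?_, by simp⟩
        apply Module.End.hasEigenvalue_of_hasEigenvector (x := v)
        refine ⟨?_, hv0⟩
        rw [Module.End.mem_eigenspace_iff]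
        have h3 : s • T v = -v := by
          rw [eq_neg_iff_add_eq_zero, add_comm]; exact h2
        have h4 := congrArg (fun w => s⁻¹ • w) h3
        simp only [smul_smul, inv_mul_cancel₀ hs0, one_smul] at h4
        rw [h4]; simp
      exact ⟨hinj, LinearMap.injective_iff_surjective.1 hinj⟩
  choose bad hc hb using key
  refine ⟨⋃ m, bad m, Set.countable_iUnion hc, ?_⟩
  intro s hs
  have hs' : ∀ m, s ∉ bad m := fun m hm => hs (Set.mem_iUnion.2 ⟨m, hm⟩)
  constructor
  · rw [injective_iff_map_eq_zero]
    intro v hv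
    obtain ⟨m, hm⟩ := hcov v
    have := (hb m s (hs' m)).1 (a₁ := ⟨v, hm⟩) (a₂ := 0) (by
      apply Subtype.ext; simpa using hv)
    simpa using congrArg Subtype.val this
  · intro v
    obtain ⟨m, hm⟩ := hcov v
    obtain ⟨u, hu⟩ := (hb m s (hs' m)).2 ⟨v, hm⟩
    exact ⟨u, by simpa using congrArg Subtype.val hu⟩

lemma exists_odd_maximal (A : Type*) [CommRing A] [Algebra ℝ A] :
    ∀ n : ℕ, ∀ (M : Type*) [AddCommGroup M] [Module A M] [Module ℝ M] [IsScalarTower ℝ A M]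
      [FiniteDimensional ℝ M], Module.finrank ℝ M = n → Odd n →
      ∃ I : Ideal A, I.IsMaximal ∧ Odd (Module.finrank ℝ (A ⧸ I)) := by
  intro n
  induction n using Nat.strong_induction_on with
  | _ n ih =>
    intro M _ _ _ _ _ hn hodd
    have : IsArtinian A M := isArtinian_of_tower ℝ inferInstance
    have : Nontrivial M := Module.nontrivial_of_finrank_pos (R := ℝ) (by rw [hn]; exact hodd.pos)
    obtain ⟨S, hS⟩ := IsAtomic.exists_atom (Submodule A M)
    have hsim : IsSimpleModule A S := isSimpleModule_iff_isAtom.2 hS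
    have hadd := Submodule.finrank_quotient_add_finrank (S.restrictScalars ℝ)
    have hq : Module.finrank ℝ (M ⧸ S.restrictScalars ℝ) = Module.finrank ℝ (M ⧸ S) := rfl
    have hs2 : Module.finrank ℝ (S.restrictScalars ℝ) = Module.finrank ℝ S := rfl
    have : FiniteDimensional ℝ S := inferInstanceAs (FiniteDimensional ℝ (S.restrictScalars ℝ))
    have : FiniteDimensional ℝ (M ⧸ S) :=
      inferInstanceAs (FiniteDimensional ℝ (M ⧸ (S.restrictScalars ℝ)))
    have hpos : 0 < Module.finrank ℝ S := by
      have : Nontrivial S := hsim.nontrivial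
      exact Module.finrank_pos
    rw [hq, hs2, hn] at hadd
    by_cases hSo : Odd (Module.finrank ℝ S)
    · obtain ⟨I, hI, ⟨e⟩⟩ := isSimpleModule_iff_quot_maximal.1 hsim
      refine ⟨I, hI, ?_⟩
      rwa [← (e.restrictScalars ℝ).finrank_eq]
    · exact ih (Module.finrank ℝ (M ⧸ S)) (by omega) (M ⧸ S) rfl (by
        rw [← hadd, Nat.odd_add] at hodd
        exact hodd.2 (by simpa using hSo))

lemma exists_character (A : Type*) [CommRing A] [Algebra ℝ A] [FiniteDimensional ℝ A]
    (h : Odd (Module.finrank ℝ A)) : Nonempty (A →ₐ[ℝ] ℝ) := by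
  obtain ⟨I, hI, hodd⟩ := exists_odd_maximal A _ A rfl h
  let _ : Field (A ⧸ I) := Ideal.Quotient.field I
  have : FiniteDimensional ℝ (A ⧸ I) := inferInstance
  have h1 : Module.finrank ℝ (A ⧸ I) = 1 := by
    obtain ⟨α, hα⟩ := Field.exists_primitive_element ℝ (A ⧸ I)
    have hintg : IsIntegral ℝ α := Algebra.IsIntegral.isIntegral α
    have h2 := IntermediateField.adjoin.finrank hintg
    rw [hα, IntermediateField.finrank_top'] at h2
    have h3 := (minpoly.irreducible hintg).degree_le_two
    have h4 : (minpoly ℝ α).natDegree ≤ 2 := Polynomial.natDegree_le_of_degree_le h3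
    rw [← h2] at h4
    obtain ⟨k, hk⟩ := hodd
    omega
  have hb : Function.Bijective (algebraMap ℝ (A ⧸ I)) := by
    have hi : Function.Injective (Algebra.linearMap ℝ (A ⧸ I)) :=
      FaithfulSMul.algebraMap_injective ℝ (A ⧸ I)
    exact ⟨hi, (LinearMap.injective_iff_surjective_of_finrank_eq_finrank (by simp [h1])).1 hi⟩
  exact ⟨((AlgEquiv.ofBijective (Algebra.ofId ℝ (A ⧸ I)) hb).symm : (A ⧸ I) →ₐ[ℝ] ℝ).comp
    (Ideal.Quotient.mkₐ ℝ I)⟩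

open MvPolynomial in
/-- The odd polynomial system `x_i ^ N + s G_i(x) = 0` has a real solution for generic `s`. -/
theorem odd_system_solvable (d N : ℕ) (hN : Odd N) (G : Fin d → MvPolynomial (Fin d) ℝ)
    (hG : ∀ i, (G i).totalDegree ≤ N) :
    ∃ bad : Set ℝ, bad.Countable ∧ ∀ s, s ∉ bad →
      ∃ x : Fin d → ℝ, ∀ i, x i ^ N + s * eval x (G i) = 0 := by
  classical
  have hidx : ∀ α : Fin d →₀ ℕ, ∃ o : Option (Fin d), (o = none → ∀ i, α i < N) ∧
      (∀ i, o = some i → N ≤ α i ∧ ∀ j < i, α j < N) := by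
    intro α
    by_cases h : ∃ i, N ≤ α i
    · let S : Finset (Fin d) := Finset.univ.filter (fun i => N ≤ α i)
      have hS : S.Nonempty := by
        obtain ⟨i, hi⟩ := h
        exact ⟨i, by simp [S, hi]⟩
      refine ⟨some (S.min' hS), by simp, ?_⟩
      intro i hi
      have hi' : S.min' hS = i := by simpa using hi
      have hm := S.min'_mem hS
      rw [hi'] at hm
      refine ⟨by simpa [S] using hm, ?_⟩
      intro j hj
      by_contra hc
      have : j ∈ S := by simp [S]; omega
      have := S.min'_le j this
      rw [hi'] at this
      exact absurd hj (not_lt.2 this)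
    · push Not at h
      exact ⟨none, fun _ => h, by simp⟩
  choose idx hnone hsome using hidx
  let mon : (Fin d →₀ ℕ) → MvPolynomial (Fin d) ℝ := fun α => monomial α 1
  have hmonmul : ∀ α β, mon α * mon β = mon (α + β) := by
    intro α β; simp [mon, monomial_mul]
  have hmondeg : ∀ α : Fin d →₀ ℕ, (mon α).totalDegree = α.degree := by
    intro α
    simp only [mon]
    rw [totalDegree_monomial _ one_ne_zero]
    rfl
  have hmonX : ∀ i k, mon (Finsupp.single i k) = X i ^ k := by
    intro i k; simp [mon, X_pow_eq_monomial]
  have hsub : ∀ (α : Fin d →₀ ℕ) (i : Fin d), N ≤ α i →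
      (α - Finsupp.single i N) + Finsupp.single i N = α := by
    intro α i h
    ext j
    by_cases hj : j = i
    · subst hj; simp; omega
    · simp [Finsupp.single_apply, Ne.symm hj]
  have hsubdeg : ∀ (α : Fin d →₀ ℕ) (i : Fin d), N ≤ α i →
      (α - Finsupp.single i N).degree + N = α.degree := by
    intro α i h
    conv_rhs => rw [← hsub α i h]
    rw [map_add]; simp
  -- the reduction operator
  let Kf : (Fin d →₀ ℕ) → MvPolynomial (Fin d) ℝ := fun α =>
    match idx α with
    | none => 0
    | some i => mon (α - Finsupp.single i N) * G i
  let b := basisMonomials (Fin d) ℝ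
  have hb : ∀ α, b α = mon α := by intro α; simp [b, mon]
  let K : MvPolynomial (Fin d) ℝ →ₗ[ℝ] MvPolynomial (Fin d) ℝ := b.constr ℝ Kf
  have hKmon : ∀ α, K (mon α) = Kf α := by
    intro α; rw [← hb]; exact b.constr_basis ℝ Kf α
  -- linear maps preserve total degree if they do so on monomials
  have hpres : ∀ (T : MvPolynomial (Fin d) ℝ →ₗ[ℝ] MvPolynomial (Fin d) ℝ),
      (∀ α, (T (mon α)).totalDegree ≤ α.degree) → ∀ m, ∀ p ∈ restrictTotalDegree (Fin d) ℝ m,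
        T p ∈ restrictTotalDegree (Fin d) ℝ m := by
    intro T hT m p hp
    rw [mem_restrictTotalDegree] at hp
    rw [p.as_sum, map_sum]
    refine Submodule.sum_mem _ ?_
    intro α hα
    have : monomial α (p.coeff α) = p.coeff α • mon α := by simp [mon, smul_monomial]
    rw [this, map_smul]
    refine Submodule.smul_mem _ _ ?_
    rw [mem_restrictTotalDegree]
    refine (hT α).trans (le_trans ?_ hp)
    exact le_totalDegree hα
  have hmulG : ∀ (α : Fin d →₀ ℕ) (i j : Fin d), N ≤ α i →
      (mon (α - Finsupp.single i N) * G j).totalDegree ≤ α.degree := by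
    intro α i j h
    refine (totalDegree_mul _ _).trans ?_
    rw [hmondeg, ← hsubdeg α i h]
    exact Nat.add_le_add_left (hG j) _
  have hKdeg : ∀ α, (K (mon α)).totalDegree ≤ α.degree := by
    intro α
    rw [hKmon]
    simp only [Kf]
    rcases h : idx α with _ | i
    · simp
    · exact hmulG α i i (hsome α i h).1
  obtain ⟨bad1, hbad1, hL⟩ := pencil_bijective (fun m => restrictTotalDegree (Fin d) ℝ m)
    (fun m => inferInstance) (fun p => ⟨p.totalDegree, by rw [mem_restrictTotalDegree]⟩)
    LinearMap.id K (fun m v hv => hv) (hpres K hKdeg) (fun m v hv => ⟨v, hv, rfl⟩)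
  -- the syzygy operator
  let UAf : Fin d → (Fin d →₀ ℕ) → (Fin d → MvPolynomial (Fin d) ℝ) := fun j γ =>
    Pi.single j (mon γ) - (match idx γ with
    | none => 0
    | some i => if i < j then
        Pi.single i (mon (γ - Finsupp.single i N + Finsupp.single j N)) else 0)
  let UKf : Fin d → (Fin d →₀ ℕ) → (Fin d → MvPolynomial (Fin d) ℝ) := fun j γ =>
    match idx γ with
    | none => 0
    | some i => if i < j then
        Pi.single j (mon (γ - Finsupp.single i N) * G i)
          - Pi.single i (mon (γ - Finsupp.single i N) * G j) else 0
  let ext2 : (Fin d → (Fin d →₀ ℕ) → (Fin d → MvPolynomial (Fin d) ℝ)) →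
      ((Fin d → MvPolynomial (Fin d) ℝ) →ₗ[ℝ] (Fin d → MvPolynomial (Fin d) ℝ)) := fun f =>
    ∑ j, (b.constr ℝ (f j)) ∘ₗ LinearMap.proj j
  have hext2 : ∀ f j γ, ext2 f (Pi.single j (mon γ)) = f j γ := by
    intro f j γ
    simp only [ext2, LinearMap.sum_apply, LinearMap.comp_apply, LinearMap.proj_apply]
    rw [Finset.sum_eq_single j]
    · rw [Pi.single_eq_same, ← hb]; exact b.constr_basis ℝ (f j) γ
    · intro k _ hk; rw [Pi.single_eq_of_ne hk]; simp
    · simp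
  let FQ : ℕ → Submodule ℝ (Fin d → MvPolynomial (Fin d) ℝ) := fun m =>
    Submodule.pi Set.univ (fun _ => restrictTotalDegree (Fin d) ℝ m)
  have hFQ : ∀ m q, q ∈ FQ m ↔ ∀ j, (q j).totalDegree ≤ m := by
    intro m q
    simp [FQ, Submodule.mem_pi, mem_restrictTotalDegree]
  have hdecomp : ∀ q : Fin d → MvPolynomial (Fin d) ℝ,
      q = ∑ j, ∑ α ∈ (q j).support, (q j).coeff α • (Pi.single j (mon α)) := by
    intro q
    have h1 : q = ∑ j, Pi.single j (q j) := (Finset.univ_sum_single q).symm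
    conv_lhs => rw [h1]
    refine Finset.sum_congr rfl fun j _ => ?_
    have h2 : q j = ∑ α ∈ (q j).support, (q j).coeff α • mon α := by
      conv_lhs => rw [(q j).as_sum]
      refine Finset.sum_congr rfl fun α _ => by simp [mon, smul_monomial]
    conv_lhs => rw [h2]
    have := map_sum (LinearMap.single ℝ (fun _ : Fin d => MvPolynomial (Fin d) ℝ) j)
      (fun α => (q j).coeff α • mon α) (q j).support
    simp only [map_smul] at this
    exact this
  have hspan : ∀ (m : ℕ) (W : Submodule ℝ (Fin d → MvPolynomial (Fin d) ℝ)),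
      (∀ j (α : Fin d →₀ ℕ), α.degree ≤ m → (Pi.single j (mon α)) ∈ W) → ∀ q ∈ FQ m, q ∈ W := by
    intro m W hW q hq
    rw [hFQ] at hq
    rw [hdecomp q]
    refine Submodule.sum_mem _ fun j _ => Submodule.sum_mem _ fun α hα => ?_
    refine Submodule.smul_mem _ _ (hW j α ?_)
    exact (le_totalDegree hα).trans (hq j)
  have hsingFQ : ∀ m j p, p.totalDegree ≤ m → Pi.single j p ∈ FQ m := by
    intro m j p hp
    rw [hFQ]
    intro k
    by_cases hk : k = j
    · subst hk; simpa using hp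
    · rw [Pi.single_eq_of_ne hk]; simp
  have hext2pres : ∀ f, (∀ j α, f j α ∈ FQ α.degree) → ∀ m, ∀ q ∈ FQ m, ext2 f q ∈ FQ m := by
    intro f hf m q hq
    refine hspan m ((FQ m).comap (ext2 f)) ?_ q hq
    intro j α hα
    rw [Submodule.mem_comap, hext2]
    have := hf j α
    rw [hFQ] at this ⊢
    exact fun k => (this k).trans hα
  have hFQfin : ∀ m, FiniteDimensional ℝ (FQ m) := by
    intro m
    let φ : FQ m →ₗ[ℝ] (Fin d → restrictTotalDegree (Fin d) ℝ m) :=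
      LinearMap.pi fun j => LinearMap.codRestrict _ ((LinearMap.proj j) ∘ₗ (FQ m).subtype) (by
        rintro ⟨q, hq⟩
        rw [hFQ] at hq
        rw [mem_restrictTotalDegree]
        exact hq j)
    refine FiniteDimensional.of_injective φ ?_
    intro q q' h
    apply Subtype.ext
    funext j
    exact congrArg Subtype.val (congrFun h j)
  have hUdeg : ∀ (γ : Fin d →₀ ℕ) (i j : Fin d), N ≤ γ i →
      (γ - Finsupp.single i N + Finsupp.single j N).degree = γ.degree := by
    intro γ i j h
    rw [map_add, ← hsubdeg γ i h]; simp
  have hUA : ∀ j α, UAf j α ∈ FQ α.degree := by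
    intro j α
    simp only [UAf]
    refine Submodule.sub_mem _ (hsingFQ _ _ _ (hmondeg α).le) ?_
    rcases h : idx α with _ | i
    · exact Submodule.zero_mem _
    · simp only
      split_ifs
      · refine hsingFQ _ _ _ ?_
        rw [hmondeg, hUdeg α i j (hsome α i h).1]
      · exact Submodule.zero_mem _
  have hUK : ∀ j α, UKf j α ∈ FQ α.degree := by
    intro j α
    simp only [UKf]
    rcases h : idx α with _ | i
    · exact Submodule.zero_mem _
    · simp only
      have hi := (hsome α i h).1
      split_ifs
      · exact Submodule.sub_mem _ (hsingFQ _ _ _ (hmulG α i i hi)) (hsingFQ _ _ _ (hmulG α i j hi))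
      · exact Submodule.zero_mem _
  have hUsurj : ∀ m, ∀ q ∈ FQ m, ∃ u ∈ FQ m, ext2 UAf u = q := by
    intro m q hq
    have : q ∈ (FQ m).map (ext2 UAf) := by
      refine hspan m _ ?_ q hq
      intro j
      induction j using WellFoundedLT.induction with
      | _ j ih =>
        intro α hα
        have h0 : Pi.single j (mon α) ∈ FQ m := hsingFQ _ _ _ ((hmondeg α).le.trans hα)
        have h1 : ext2 UAf (Pi.single j (mon α)) ∈ (FQ m).map (ext2 UAf) :=
          Submodule.mem_map_of_mem h0
        rw [hext2] at h1
        simp only [UAf] at h1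
        rcases h : idx α with _ | i
        · rw [h] at h1; simpa using h1
        · rw [h] at h1
          simp only at h1
          split_ifs at h1 with hij
          · have h2 := ih i hij (α - Finsupp.single i N + Finsupp.single j N)
              (by rw [hUdeg α i j (hsome α i h).1]; exact hα)
            have h3 := Submodule.add_mem _ h1 h2
            rwa [sub_add_cancel] at h3
          · simpa using h1
    exact this
  obtain ⟨bad2, hbad2, hU⟩ := pencil_bijective FQ hFQfin
    (fun q => ⟨∑ j, (q j).totalDegree, by
      rw [hFQ]
      intro j
      exact Finset.single_le_sum (f := fun j => (q j).totalDegree) (fun _ _ => Nat.zero_le _)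
        (Finset.mem_univ j)⟩)
    (ext2 UAf) (ext2 UKf) (hext2pres _ hUA) (hext2pres _ hUK) hUsurj
  refine ⟨bad1 ∪ bad2, hbad1.union hbad2, ?_⟩
  intro s hs
  have hLs := hL s (fun h => hs (Or.inl h))
  have hUs := hU s (fun h => hs (Or.inr h))
  let f : Fin d → MvPolynomial (Fin d) ℝ := fun i => X i ^ N + s • G i
  let L := LinearEquiv.ofBijective (LinearMap.id + s • K) hLs
  have hLapp : ∀ p, L p = p + s • K p := fun p => rfl
  let π : MvPolynomial (Fin d) ℝ →ₗ[ℝ] ((Fin d → Fin N) → ℝ) :=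
    (LinearMap.pi fun β : Fin d → Fin N =>
      lcoeff ℝ (Finsupp.equivFunOnFinite.symm (fun i => (β i : ℕ)))) ∘ₗ L.symm.toLinearMap
  have hπ : ∀ p β, π (L p) β = p.coeff (Finsupp.equivFunOnFinite.symm (fun i => (β i : ℕ))) := by
    intro p β
    simp [π]
  have hLnone : ∀ α, idx α = none → L (mon α) = mon α := by
    intro α h
    rw [hLapp, hKmon]
    simp [Kf, h]
  have hLsome : ∀ α i, idx α = some i → L (mon α) = mon (α - Finsupp.single i N) * f i := by
    intro α i h
    rw [hLapp, hKmon]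
    simp only [Kf, h, f]
    rw [mul_add, ← hmonX, hmonmul, hsub α i (hsome α i h).1, mul_smul_comm]
  have hidxB : ∀ α : Fin d →₀ ℕ, (∀ i, α i < N) → idx α = none := by
    intro α h
    rcases h' : idx α with _ | i
    · rfl
    · exact absurd (h i) (not_lt.2 (hsome α i h').1)
  have hπsurj : Function.Surjective π := by
    intro c
    refine ⟨L (∑ β, c β • mon (Finsupp.equivFunOnFinite.symm (fun i => ((β i : Fin N) : ℕ)))), ?_⟩
    funext β
    rw [hπ]
    simp only [coeff_sum, mon, coeff_smul, coeff_monomial]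
    rw [Finset.sum_eq_single β]
    · simp
    · intro β' _ hne
      rw [if_neg]
      · simp
      · intro h
        apply hne
        have := Finsupp.equivFunOnFinite.symm.injective h
        funext i
        exact Fin.ext (congrFun this i)
    · simp
  let I : Ideal (MvPolynomial (Fin d) ℝ) := Ideal.span (Set.range f)
  let ev : (Fin d → MvPolynomial (Fin d) ℝ) →ₗ[ℝ] MvPolynomial (Fin d) ℝ :=
    ∑ j, (LinearMap.mulRight ℝ (f j)) ∘ₗ LinearMap.proj j
  have hev : ∀ q, ev q = ∑ j, q j * f j := by
    intro q; simp [ev]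
  have hevsing : ∀ j p, ev (Pi.single j p) = p * f j := by
    intro j p
    rw [hev, Finset.sum_eq_single j]
    · simp
    · intro k _ hk; rw [Pi.single_eq_of_ne hk]; simp
    · simp
  have hevU : ∀ j γ, π (ev ((ext2 UAf + s • ext2 UKf) (Pi.single j (mon γ)))) = 0 := by
    intro j γ
    rw [LinearMap.add_apply, LinearMap.smul_apply, hext2, hext2]
    have normal : (∀ k < j, γ k < N) → π (ev (Pi.single j (mon γ))) = 0 := by
      intro hnorm
      have hid : idx (γ + Finsupp.single j N) = some j := by
        rcases h' : idx (γ + Finsupp.single j N) with _ | i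
        · have := hnone _ h' j
          simp at this
        · have h1 := hsome _ i h'
          rcases lt_trichotomy i j with hlt | heq | hgt
          · have h2 := h1.1
            have := hnorm i hlt
            simp [Finsupp.single_apply, hlt.ne'] at h2
            omega
          · rw [heq]
          · have h2 := h1.2 j hgt
            simp at h2
      have h3 := hLsome _ j hid
      rw [add_tsub_cancel_right] at h3
      rw [hevsing, ← h3]
      funext β
      rw [hπ]
      simp only [mon, coeff_monomial]
      rw [if_neg]
      · rfl
      · intro h
        have := DFunLike.congr_fun h j
        simp at this
        have h4 := (β j).2
        omega
    rcases h : idx γ with _ | i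
    · simp only [UAf, UKf, h]
      simpa using normal (fun k _ => hnone γ h k)
    · by_cases hij : i < j
      · simp only [UAf, UKf, h, if_pos hij]
        have : ev (Pi.single j (mon γ)
            - Pi.single i (mon (γ - Finsupp.single i N + Finsupp.single j N))
            + s • (Pi.single j (mon (γ - Finsupp.single i N) * G i)
              - Pi.single i (mon (γ - Finsupp.single i N) * G j))) = 0 := by
          simp only [map_add, map_sub, map_smul, hevsing]
          have e1 : mon γ = mon (γ - Finsupp.single i N) * X i ^ N := by
            rw [← hmonX, hmonmul, hsub γ i (hsome γ i h).1]
          rw [e1, ← hmonmul, hmonX]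
          simp only [f, smul_eq_C_mul]
          ring
        rw [this, map_zero]
      · simp only [UAf, UKf, h, if_neg hij]
        simpa using normal (fun k hk => (hsome γ i h).2 k (lt_of_lt_of_le hk (not_lt.1 hij)))
  have hevπ : ∀ q, π (ev q) = 0 := by
    intro q
    obtain ⟨u, rfl⟩ := hUs.2 q
    rw [hdecomp u]
    simp only [map_sum, map_smul, hevU, smul_zero, Finset.sum_const_zero]
  have hker : ∀ p, p ∈ I ↔ π p = 0 := by
    intro p
    constructor
    · intro hp
      obtain ⟨c, hc⟩ := (Submodule.mem_span_range_iff_exists_fun _).1 hp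
      rw [← hc]
      have := hevπ c
      rw [hev] at this
      simpa using this
    · intro hp
      obtain ⟨q, rfl⟩ := L.surjective p
      have hq : q = ∑ α ∈ q.support, q.coeff α • mon α := by
        conv_lhs => rw [q.as_sum]
        refine Finset.sum_congr rfl fun α _ => by simp [mon, smul_monomial]
      rw [hq, map_sum]
      refine Ideal.sum_mem _ fun α hα => ?_
      rw [map_smul, smul_eq_C_mul]
      refine Ideal.mul_mem_left _ _ ?_
      rcases h : idx α with _ | i
      · exfalso
        have hlt := hnone α h
        have h1 := congrFun hp (fun i => ⟨α i, hlt i⟩)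
        rw [hπ] at h1
        have h2 : Finsupp.equivFunOnFinite.symm (fun i => α i) = α := by ext; simp
        simp only [h2] at h1
        exact (mem_support_iff.1 hα) h1
      · rw [hLsome α i h]
        exact Ideal.mul_mem_left _ _ (Ideal.subset_span ⟨i, rfl⟩)
  have hkereq : I.restrictScalars ℝ = LinearMap.ker π := by
    ext p
    rw [Submodule.restrictScalars_mem, LinearMap.mem_ker]
    exact hker p
  let e1 : (MvPolynomial (Fin d) ℝ ⧸ I.restrictScalars ℝ) ≃ₗ[ℝ] ((Fin d → Fin N) → ℝ) :=
    (Submodule.quotEquivOfEq _ _ hkereq).trans (LinearMap.quotKerEquivOfSurjective π hπsurj)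
  let e : (MvPolynomial (Fin d) ℝ ⧸ I) ≃ₗ[ℝ] ((Fin d → Fin N) → ℝ) := e1
  have : FiniteDimensional ℝ (MvPolynomial (Fin d) ℝ ⧸ I) := e.symm.finiteDimensional
  have hfr : Module.finrank ℝ (MvPolynomial (Fin d) ℝ ⧸ I) = N ^ d := by
    rw [e.finrank_eq]; simp
  obtain ⟨χ⟩ := exists_character (MvPolynomial (Fin d) ℝ ⧸ I) (by rw [hfr]; exact hN.pow)
  let ψ : MvPolynomial (Fin d) ℝ →ₐ[ℝ] ℝ := χ.comp (Ideal.Quotient.mkₐ ℝ I)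
  refine ⟨fun i => ψ (X i), ?_⟩
  intro i
  have h1 : ψ (f i) = 0 := by
    have : Ideal.Quotient.mkₐ ℝ I (f i) = 0 := by
      rw [Ideal.Quotient.mkₐ_eq_mk, Ideal.Quotient.eq_zero_iff_mem]
      exact Ideal.subset_span ⟨i, rfl⟩
    simp only [ψ, AlgHom.comp_apply, this, map_zero]
  have h2 : ∀ p, ψ p = eval (fun i => ψ (X i)) p := by
    intro p
    have : ψ = aeval (fun i => ψ (X i)) := by
      apply MvPolynomial.algHom_ext; intro j; simp
    conv_lhs => rw [this]
    rw [aeval_def, eval]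
    rfl
  rw [h2] at h1
  simpa [f, smul_eval] using h1

/-- The affine functional with coefficients `(w0, w)`. -/
noncomputable def affFun {d : ℕ} (w : ℝ × (Fin d → ℝ)) (p : EuclideanSpace ℝ (Fin d)) : ℝ :=
  w.1 + ∑ k, w.2 k * p k

set_option maxHeartbeats 1000000 in
open MvPolynomial in
lemma approx_ham_sandwich (d : ℕ) (C : Fin d → Finset (EuclideanSpace ℝ (Fin d)))
    (φ : ℝ → ℝ) (hφ : Continuous φ) (hodd : ∀ z, φ (-z) = - φ z) (ε : ℝ) (hε : 0 < ε) :
    ∃ w : ℝ × (Fin d → ℝ), w.1 ^ 2 + ∑ k, w.2 k ^ 2 = 1 ∧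
      ∀ i, |∑ p ∈ C i, φ (affFun w p)| ≤ ε := by
  classical
  let R : ℝ := 1 + ∑ i, ∑ p ∈ C i, ∑ k, |p k|
  have hR : ∀ w : ℝ × (Fin d → ℝ), w.1 ^ 2 + ∑ k, w.2 k ^ 2 = 1 → ∀ i, ∀ p ∈ C i,
      |affFun w p| ≤ R := by
    intro w hw i p hp
    have hs : 0 ≤ ∑ k, w.2 k ^ 2 := Finset.sum_nonneg fun k _ => sq_nonneg _
    have h0 : |w.1| ≤ 1 := by rw [← sq_le_one_iff_abs_le_one]; linarith
    have hk : ∀ k, |w.2 k| ≤ 1 := by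
      intro k
      rw [← sq_le_one_iff_abs_le_one]
      have := Finset.single_le_sum (f := fun k => w.2 k ^ 2) (fun k _ => sq_nonneg _)
        (Finset.mem_univ k)
      nlinarith [sq_nonneg w.1]
    have h1 : |∑ k, w.2 k * p k| ≤ ∑ k, |p k| := by
      refine (Finset.abs_sum_le_sum_abs _ _).trans (Finset.sum_le_sum fun k _ => ?_)
      rw [abs_mul]
      nlinarith [hk k, abs_nonneg (p k)]
    have h2 : ∑ k, |p k| ≤ ∑ p ∈ C i, ∑ k, |p k| :=
      Finset.single_le_sum (f := fun p : EuclideanSpace ℝ (Fin d) => ∑ k, |p k|)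
        (fun p _ => Finset.sum_nonneg fun k _ => abs_nonneg _) hp
    have h3 : ∑ p ∈ C i, ∑ k, |p k| ≤ ∑ i, ∑ p ∈ C i, ∑ k, |p k| :=
      Finset.single_le_sum (f := fun i => ∑ p ∈ C i, ∑ k, |p k|)
        (fun i _ => Finset.sum_nonneg fun p _ => Finset.sum_nonneg fun k _ => abs_nonneg _)
        (Finset.mem_univ i)
    calc |affFun w p| ≤ |w.1| + |∑ k, w.2 k * p k| := abs_add_le _ _
      _ ≤ R := add_le_add h0 (h1.trans (h2.trans h3))
  let M : ℝ := ((∑ i, (C i).card : ℕ) : ℝ) + 1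
  have hM : ∀ i, ((C i).card : ℝ) ≤ M := by
    intro i
    have : (C i).card ≤ ∑ i, (C i).card :=
      Finset.single_le_sum (f := fun i => (C i).card) (fun _ _ => Nat.zero_le _)
        (Finset.mem_univ i)
    have : ((C i).card : ℝ) ≤ ((∑ i, (C i).card : ℕ) : ℝ) := by exact_mod_cast this
    exact this.trans (le_add_of_nonneg_right zero_le_one)
  have hMpos : 0 < M := by
    have : (0 : ℝ) ≤ ((∑ i, (C i).card : ℕ) : ℝ) := Nat.cast_nonneg _
    exact add_pos_of_nonneg_of_pos this one_pos
  clear_value R M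
  obtain ⟨q, hq⟩ := exists_polynomial_near_of_continuousOn (-R) R φ hφ.continuousOn
    (ε / (2 * M)) (by positivity)
  obtain ⟨D, hD⟩ : ∃ D, D = q.natDegree := ⟨_, rfl⟩
  obtain ⟨N, hN⟩ : ∃ N, N = 2 * D + 1 := ⟨_, rfl⟩
  let J := (Finset.range (D + 1)).filter (fun j => Odd j)
  let qo : ℝ → ℝ := fun z => ∑ j ∈ J, q.coeff j * z ^ j
  have hqo : ∀ z, qo z = (q.eval z - q.eval (-z)) / 2 := by
    intro z
    rw [Polynomial.eval_eq_sum_range, Polynomial.eval_eq_sum_range, ← Finset.sum_sub_distrib,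
      Finset.sum_div]
    simp only [qo, J]
    rw [Finset.sum_filter, hD]
    refine Finset.sum_congr rfl fun j _ => ?_
    split_ifs with h
    · rw [h.neg_pow]; ring
    · rw [(Nat.not_odd_iff_even.1 h).neg_pow]; ring
  have hqoφ : ∀ z, |z| ≤ R → |qo z - φ z| ≤ ε / (2 * M) := by
    intro z hz
    have hz' := abs_le.1 hz
    have h1 := abs_lt.1 (hq z ⟨by linarith, by linarith⟩)
    have h2 := abs_lt.1 (hq (-z) ⟨by linarith, by linarith⟩)
    rw [hodd] at h2
    rw [hqo, abs_le]
    constructor <;> linarith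
  let G : Fin d → MvPolynomial (Fin d) ℝ := fun i => ∑ p ∈ C i, ∑ j ∈ J,
    MvPolynomial.C (q.coeff j) * ((1 + ∑ k, MvPolynomial.C (p k) * X k) ^ j
      * (1 + ∑ k, X k ^ 2) ^ ((N - j) / 2))
  have hGdeg : ∀ i, (G i).totalDegree ≤ N := by
    intro i
    refine totalDegree_finsetSum_le fun p hp => totalDegree_finsetSum_le fun j hj => ?_
    have hjD : j ≤ D := by
      have := (Finset.mem_filter.1 hj).1
      rw [Finset.mem_range] at this; omega
    have ha : (1 + ∑ k, MvPolynomial.C (p k) * X k : MvPolynomial (Fin d) ℝ).totalDegree ≤ 1 := by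
      refine (totalDegree_add _ _).trans (max_le (by simp) ?_)
      refine totalDegree_finsetSum_le fun k _ => ?_
      refine (totalDegree_mul _ _).trans ?_
      simp
    have hb : (1 + ∑ k, X k ^ 2 : MvPolynomial (Fin d) ℝ).totalDegree ≤ 2 := by
      refine (totalDegree_add _ _).trans (max_le (by simp) ?_)
      refine totalDegree_finsetSum_le fun k _ => ?_
      exact (totalDegree_pow _ _).trans (by simp)
    refine (totalDegree_mul _ _).trans ?_
    rw [totalDegree_C, zero_add]
    refine (totalDegree_mul _ _).trans ?_
    have ha' := (totalDegree_pow (1 + ∑ k, MvPolynomial.C (p k) * X k : MvPolynomial (Fin d) ℝ) j)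
    have hb' := (totalDegree_pow (1 + ∑ k, X k ^ 2 : MvPolynomial (Fin d) ℝ) ((N - j) / 2))
    have ha'' := Nat.mul_le_mul_left j ha
    have hb'' := Nat.mul_le_mul_left ((N - j) / 2) hb
    omega
  obtain ⟨bad, hbad, hsol⟩ := odd_system_solvable d N ⟨D, hN⟩ G hGdeg
  obtain ⟨s, hs1, hs2⟩ : ∃ s : ℝ, 2 / ε < s ∧ s ∉ bad := by
    by_contra hcon
    push Not at hcon
    have : (Set.Ioi (2 / ε)).Countable := hbad.mono hcon
    rw [← Cardinal.le_aleph0_iff_set_countable, Cardinal.mk_Ioi_real] at this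
    exact absurd this (not_le.2 Cardinal.aleph0_lt_continuum)
  obtain ⟨x, hx⟩ := hsol s hs2
  let r : ℝ := √(1 + ∑ k, x k ^ 2)
  have hsum : 0 ≤ ∑ k, x k ^ 2 := Finset.sum_nonneg fun k _ => sq_nonneg _
  have hr2 : r ^ 2 = 1 + ∑ k, x k ^ 2 := Real.sq_sqrt (by linarith)
  have hr : 0 < r := Real.sqrt_pos.2 (by linarith)
  let w : ℝ × (Fin d → ℝ) := (1 / r, fun k => x k / r)
  have hw : w.1 ^ 2 + ∑ k, w.2 k ^ 2 = 1 := by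
    simp only [w, div_pow, ← Finset.sum_div]
    rw [hr2]; field_simp
  refine ⟨w, hw, ?_⟩
  intro i
  have hspos : 0 < s := lt_trans (by positivity) hs1
  have hGe : eval x (G i) = r ^ N * ∑ p ∈ C i, qo (affFun w p) := by
    simp only [G, map_sum, map_mul, map_pow, map_add, map_one, eval_C, eval_X, qo]
    rw [Finset.mul_sum]
    refine Finset.sum_congr rfl fun p hp => ?_
    rw [Finset.mul_sum]
    refine Finset.sum_congr rfl fun j hj => ?_
    have hjo := (Finset.mem_filter.1 hj).2
    have hjD : j ≤ D := by
      have := (Finset.mem_filter.1 hj).1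
      rw [Finset.mem_range] at this; omega
    have hl : affFun w p = (1 + ∑ k, p k * x k) / r := by
      simp only [affFun, w]
      rw [add_div, Finset.sum_div]
      congr 1
      refine Finset.sum_congr rfl fun k _ => by ring
    rw [hl, ← hr2, ← pow_mul, div_pow]
    obtain ⟨c, hc⟩ := hjo
    have h2 : 2 * ((N - j) / 2) = N - j := by omega
    rw [h2]
    have h3 : r ^ N = r ^ (N - j) * r ^ j := by rw [← pow_add]; congr 1; omega
    rw [h3]
    field_simp
  have hxi : |x i / r| ≤ 1 := by
    rw [← sq_le_one_iff_abs_le_one]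
    have := Finset.single_le_sum (f := fun k => w.2 k ^ 2) (fun k _ => sq_nonneg _)
        (Finset.mem_univ i)
    simp only [w] at this hw
    nlinarith [sq_nonneg (1 / r)]
  have hq1 : |∑ p ∈ C i, qo (affFun w p)| ≤ ε / 2 := by
    have h1 := hx i
    rw [hGe] at h1
    have h2 : ∑ p ∈ C i, qo (affFun w p) = - (x i / r) ^ N / s := by
      have hrN : r ^ N ≠ 0 := by positivity
      rw [div_pow]
      field_simp
      linarith
    rw [h2, abs_div, abs_neg, abs_pow, abs_of_pos hspos, div_le_iff₀ hspos]
    have h3 : |x i / r| ^ N ≤ 1 := pow_le_one₀ (abs_nonneg _) hxi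
    have h4 : 2 < s * ε := by rwa [div_lt_iff₀ hε] at hs1
    linarith
  have hq2 : |∑ p ∈ C i, φ (affFun w p) - ∑ p ∈ C i, qo (affFun w p)| ≤ ε / 2 := by
    rw [← Finset.sum_sub_distrib]
    refine (Finset.abs_sum_le_sum_abs _ _).trans ?_
    refine (Finset.sum_le_card_nsmul _ _ (ε / (2 * M)) fun p hp => ?_).trans ?_
    · rw [abs_sub_comm]; exact hqoφ _ (hR w hw i p hp)
    · rw [nsmul_eq_mul]
      calc ((C i).card : ℝ) * (ε / (2 * M)) ≤ M * (ε / (2 * M)) :=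
            mul_le_mul_of_nonneg_right (hM i) (by positivity)
        _ = ε / 2 := by field_simp
  have h5 := abs_le.1 hq1
  have h6 := abs_le.1 hq2
  rw [abs_le]
  constructor <;> linarith

open Filter Topology in
/-- Discrete ham sandwich theorem. -/
theorem discrete_ham_sandwich (d : ℕ) (C : Fin d → Finset (EuclideanSpace ℝ (Fin d))) :
    ∃ w : ℝ × (Fin d → ℝ), w.1 ^ 2 + ∑ k, w.2 k ^ 2 = 1 ∧
      ∀ i, ((C i).filter (fun p => 0 < affFun w p)).card ≤
          ((C i).filter (fun p => affFun w p < 0)).card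
            + ((C i).filter (fun p => affFun w p = 0)).card ∧
        ((C i).filter (fun p => affFun w p < 0)).card ≤
          ((C i).filter (fun p => 0 < affFun w p)).card
            + ((C i).filter (fun p => affFun w p = 0)).card := by
  classical
  let φ : ℕ → ℝ → ℝ := fun n z => max (-1) (min 1 ((n : ℝ) * z))
  have hφc : ∀ n, Continuous (φ n) := by intro n; fun_prop
  have hφo : ∀ n z, φ n (-z) = - φ n z := by
    intro n z
    simp only [φ]
    rcases le_total ((n : ℝ) * z) (-1) with h1 | h1
    · rw [min_eq_left (by linarith), min_eq_right (by linarith), max_eq_right (by norm_num),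
        max_eq_left h1]; norm_num
    · rcases le_total ((n : ℝ) * z) 1 with h2 | h2
      · rw [min_eq_right (by linarith), min_eq_right h2, max_eq_right (by linarith),
          max_eq_right h1]; ring
      · rw [min_eq_right (by linarith), min_eq_left h2, max_eq_left (by linarith),
          max_eq_right (by norm_num)]
  have hφb : ∀ n z, |φ n z| ≤ 1 := by
    intro n z
    rw [abs_le]
    exact ⟨le_max_left _ _, max_le (by norm_num) (min_le_left _ _)⟩
  have hex := fun n : ℕ => approx_ham_sandwich d C (φ n) (hφc n) (hφo n) (1 / 2) (by norm_num)
  choose w hw1 hw2 using hex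
  let S : Set (ℝ × (Fin d → ℝ)) := {w | w.1 ^ 2 + ∑ k, w.2 k ^ 2 = 1}
  have hS : IsCompact S := by
    refine Metric.isCompact_of_isClosed_isBounded ?_ ?_
    · exact isClosed_eq (by fun_prop) continuous_const
    · refine (Metric.isBounded_closedBall (x := (0 : ℝ × (Fin d → ℝ))) (r := 1)).subset ?_
      intro v hv
      have hv' : v.1 ^ 2 + ∑ k, v.2 k ^ 2 = 1 := hv
      rw [mem_closedBall_zero_iff, Prod.norm_def]
      refine max_le ?_ ?_
      · rw [Real.norm_eq_abs, ← sq_le_one_iff_abs_le_one]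
        have : 0 ≤ ∑ k, v.2 k ^ 2 := Finset.sum_nonneg fun k _ => sq_nonneg _
        linarith
      · rw [pi_norm_le_iff_of_nonneg zero_le_one]
        intro k
        rw [Real.norm_eq_abs, ← sq_le_one_iff_abs_le_one]
        have := Finset.single_le_sum (f := fun k => v.2 k ^ 2) (fun k _ => sq_nonneg _)
          (Finset.mem_univ k)
        nlinarith [sq_nonneg v.1]
  obtain ⟨v, hv, θ, hθ, hlim⟩ := hS.tendsto_subseq (x := w) (fun n => hw1 n)
  refine ⟨v, hv, ?_⟩
  have hcont : ∀ p : EuclideanSpace ℝ (Fin d), Tendsto (fun n => affFun (w (θ n)) p) atTop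
      (𝓝 (affFun v p)) := by
    intro p
    have : Continuous (fun u : ℝ × (Fin d → ℝ) => affFun u p) := by unfold affFun; fun_prop
    exact (this.tendsto v).comp hlim
  have hlarge : Tendsto (fun n => ((θ n : ℕ) : ℝ)) atTop atTop :=
    tendsto_natCast_atTop_atTop.comp hθ.tendsto_atTop
  have hpos : ∀ p : EuclideanSpace ℝ (Fin d), 0 < affFun v p →
      ∀ᶠ n in atTop, φ (θ n) (affFun (w (θ n)) p) = 1 := by
    intro p hp
    have := (hlarge.atTop_mul_pos hp (hcont p)).eventually_ge_atTop 1
    filter_upwards [this] with n hn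
    simp only [φ]
    rw [min_eq_left hn]; norm_num
  have hneg : ∀ p : EuclideanSpace ℝ (Fin d), affFun v p < 0 →
      ∀ᶠ n in atTop, φ (θ n) (affFun (w (θ n)) p) = -1 := by
    intro p hp
    have := (hlarge.atTop_mul_neg hp (hcont p)).eventually_le_atBot (-1)
    filter_upwards [this] with n hn
    simp only [φ]
    rw [min_eq_right (by linarith), max_eq_left hn]
  intro i
  have hall : ∀ᶠ n in atTop, ∀ p ∈ C i, (0 < affFun v p → φ (θ n) (affFun (w (θ n)) p) = 1) ∧
      (affFun v p < 0 → φ (θ n) (affFun (w (θ n)) p) = -1) := by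
    rw [Filter.eventually_all_finset]
    intro p hp
    refine Filter.Eventually.and ?_ ?_
    · by_cases h : 0 < affFun v p
      · filter_upwards [hpos p h] with n hn _ using hn
      · exact Filter.Eventually.of_forall fun n h' => absurd h' h
    · by_cases h : affFun v p < 0
      · filter_upwards [hneg p h] with n hn _ using hn
      · exact Filter.Eventually.of_forall fun n h' => absurd h' h
  obtain ⟨n, hn⟩ := hall.exists
  have hsum := abs_le.1 (hw2 (θ n) i)
  set P := ((C i).filter (fun p => 0 < affFun v p)).card
  set Q := ((C i).filter (fun p => affFun v p < 0)).card
  set Z := ((C i).filter (fun p => affFun v p = 0)).card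
  have hP : (P : ℝ) = ∑ p ∈ C i, if 0 < affFun v p then (1 : ℝ) else 0 := by simp [P]
  have hQ : (Q : ℝ) = ∑ p ∈ C i, if affFun v p < 0 then (1 : ℝ) else 0 := by simp [Q]
  have hZ : (Z : ℝ) = ∑ p ∈ C i, if affFun v p = 0 then (1 : ℝ) else 0 := by simp [Z]
  have hlo : (P : ℝ) - Q - Z ≤ ∑ p ∈ C i, φ (θ n) (affFun (w (θ n)) p) := by
    rw [hP, hQ, hZ, ← Finset.sum_sub_distrib, ← Finset.sum_sub_distrib]
    refine Finset.sum_le_sum fun p hp => ?_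
    have hb := abs_le.1 (hφb (θ n) (affFun (w (θ n)) p))
    rcases lt_trichotomy (affFun v p) 0 with h | h | h
    · rw [(hn p hp).2 h]; simp [h, h.not_gt, h.ne]
    · simp [h]; linarith
    · rw [(hn p hp).1 h]; simp [h, h.not_gt, h.ne']
  have hhi : ∑ p ∈ C i, φ (θ n) (affFun (w (θ n)) p) ≤ (P : ℝ) - Q + Z := by
    rw [hP, hQ, hZ, ← Finset.sum_sub_distrib, ← Finset.sum_add_distrib]
    refine Finset.sum_le_sum fun p hp => ?_
    have hb := abs_le.1 (hφb (θ n) (affFun (w (θ n)) p))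
    rcases lt_trichotomy (affFun v p) 0 with h | h | h
    · rw [(hn p hp).2 h]; simp [h, h.not_gt, h.ne]
    · simp [h]; linarith
    · rw [(hn p hp).1 h]; simp [h, h.not_gt, h.ne']
  constructor
  · have : (P : ℝ) < Q + Z + 1 := by linarith
    have : P < Q + Z + 1 := by exact_mod_cast this
    omega
  · have : (Q : ℝ) < P + Z + 1 := by linarith
    have : Q < P + Z + 1 := by exact_mod_cast this
    omega

lemma affFun_neg {d : ℕ} (w : ℝ × (Fin d → ℝ)) (p : EuclideanSpace ℝ (Fin d)) :
    affFun (-w) p = - affFun w p := by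
  simp [affFun, Finset.sum_neg_distrib]
  ring

lemma affFun_combo {d : ℕ} (w : ℝ × (Fin d → ℝ)) (A : Finset (EuclideanSpace ℝ (Fin d)))
    (g : EuclideanSpace ℝ (Fin d) → ℝ) (hg : ∑ y ∈ A, g y = 1) :
    affFun w (∑ y ∈ A, g y • y) = ∑ y ∈ A, g y * affFun w y := by
  have h1 : ∀ k, (∑ y ∈ A, g y • y) k = ∑ y ∈ A, g y * y k := by
    intro k
    simp
  simp only [affFun, h1, mul_add, Finset.sum_add_distrib]
  rw [← Finset.sum_mul, hg, one_mul]
  congr 1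
  simp only [Finset.mul_sum]
  rw [Finset.sum_comm]
  refine Finset.sum_congr rfl fun y _ => Finset.sum_congr rfl fun k _ => by ring

lemma card_on_hyperplane {d : ℕ} (X : Finset (EuclideanSpace ℝ (Fin d))) (hX : GenPos d X)
    (w : ℝ × (Fin d → ℝ)) (hw : w.2 ≠ 0) :
    (X.filter (fun p => affFun w p = 0)).card ≤ d := by
  by_contra hcon
  push Not at hcon
  obtain ⟨S, hS, hSc⟩ := Finset.exists_subset_card_eq (Nat.succ_le_of_lt hcon)
  have hSX : S ⊆ X := hS.trans (Finset.filter_subset _ _)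
  have hai := hX S hSX hSc.le
  have htop := (hai.affineSpan_eq_top_iff_card_eq_finrank_add_one).2 (by simp [hSc])
  let H : AffineSubspace ℝ (EuclideanSpace ℝ (Fin d)) :=
    { carrier := {p | affFun w p = 0}
      smul_vsub_vadd_mem' := by
        intro c p1 p2 p3 h1 h2 h3
        simp only [Set.mem_setOf_eq, affFun] at h1 h2 h3 ⊢
        have : ∑ k, w.2 k * (c • (p1 -ᵥ p2) +ᵥ p3) k =
            c * (∑ k, w.2 k * p1 k) - c * (∑ k, w.2 k * p2 k) + ∑ k, w.2 k * p3 k := by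
          rw [Finset.mul_sum, Finset.mul_sum, ← Finset.sum_sub_distrib, ← Finset.sum_add_distrib]
          refine Finset.sum_congr rfl fun k _ => ?_
          simp
          ring
        rw [this]
        linear_combination c * h1 - c * h2 + h3 }
  have hle : affineSpan ℝ (Set.range (fun p : S => (p : EuclideanSpace ℝ (Fin d)))) ≤ H := by
    rw [affineSpan_le]
    rintro _ ⟨⟨p, hp⟩, rfl⟩
    exact (Finset.mem_filter.1 (hS hp)).2
  rw [htop] at hle
  have hall : ∀ p, affFun w p = 0 := fun p => hle (AffineSubspace.mem_top ℝ _ p)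
  have h0 := hall 0
  apply hw
  funext k
  have hk := hall (EuclideanSpace.single k 1)
  simp [affFun] at h0 hk
  rw [h0] at hk
  simpa [Pi.single_apply] using hk

lemma hull_face {d : ℕ} (w : ℝ × (Fin d → ℝ)) (A : Finset (EuclideanSpace ℝ (Fin d)))
    (hA : ∀ p ∈ A, 0 ≤ affFun w p) (z : EuclideanSpace ℝ (Fin d))
    (hz : z ∈ convexHull ℝ (A : Set (EuclideanSpace ℝ (Fin d)))) (hz0 : affFun w z ≤ 0) :
    z ∈ convexHull ℝ
      ((A.filter (fun p => affFun w p = 0) : Finset _) : Set (EuclideanSpace ℝ (Fin d))) := by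
  rw [Finset.mem_convexHull'] at hz ⊢
  obtain ⟨g, hg0, hg1, hgz⟩ := hz
  rw [← hgz, affFun_combo w A g hg1] at hz0
  have hterm : ∀ p ∈ A, 0 ≤ g p * affFun w p := fun p hp => mul_nonneg (hg0 p hp) (hA p hp)
  have hsum := le_antisymm hz0 (Finset.sum_nonneg hterm)
  rw [Finset.sum_eq_zero_iff_of_nonneg hterm] at hsum
  have hzero : ∀ p ∈ A, affFun w p ≠ 0 → g p = 0 := by
    intro p hp hne
    exact (mul_eq_zero.1 (hsum p hp)).resolve_right hne
  refine ⟨g, fun p hp => hg0 p (Finset.mem_filter.1 hp).1, ?_, ?_⟩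
  · rw [← hg1]
    refine Finset.sum_subset (Finset.filter_subset _ _) ?_
    intro p hp hp'
    exact hzero p hp fun h => hp' (Finset.mem_filter.2 ⟨hp, h⟩)
  · rw [← hgz]
    refine Finset.sum_subset (Finset.filter_subset _ _) ?_
    intro p hp hp'
    rw [hzero p hp fun h => hp' (Finset.mem_filter.2 ⟨hp, h⟩), zero_smul]

lemma hull_disjoint {d : ℕ} (X A B : Finset (EuclideanSpace ℝ (Fin d))) (hX : GenPos d X)
    (hAX : A ⊆ X) (hBX : B ⊆ X) (hAB : Disjoint A B)
    (w : ℝ × (Fin d → ℝ)) (hw : w.2 ≠ 0)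
    (hA : ∀ p ∈ A, 0 ≤ affFun w p) (hB : ∀ p ∈ B, affFun w p ≤ 0) :
    Disjoint (convexHull ℝ (A : Set (EuclideanSpace ℝ (Fin d))))
      (convexHull ℝ (B : Set (EuclideanSpace ℝ (Fin d)))) := by
  rw [Set.disjoint_left]
  intro z hzA hzB
  have hA1 : 0 ≤ affFun w z := by
    rw [Finset.mem_convexHull'] at hzA
    obtain ⟨g, hg0, hg1, hgz⟩ := hzA
    rw [← hgz, affFun_combo w A g hg1]
    exact Finset.sum_nonneg fun p hp => mul_nonneg (hg0 p hp) (hA p hp)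
  have hB1 : affFun w z ≤ 0 := by
    rw [Finset.mem_convexHull'] at hzB
    obtain ⟨g, hg0, hg1, hgz⟩ := hzB
    rw [← hgz, affFun_combo w B g hg1]
    exact Finset.sum_nonpos fun p hp => mul_nonpos_of_nonneg_of_nonpos (hg0 p hp) (hB p hp)
  have h1 := hull_face w A hA z hzA hB1
  have h2 := hull_face (-w) B (fun p hp => by rw [affFun_neg]; linarith [hB p hp]) z hzB
    (by rw [affFun_neg]; linarith)
  simp only [affFun_neg, neg_eq_zero] at h2
  have hai := hX (X.filter (fun p => affFun w p = 0)) (Finset.filter_subset _ _)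
    ((card_on_hyperplane X hX w hw).trans (Nat.le_succ d))
  have hintg := hai.convexHull_inter (t₁ := A.filter (fun p => affFun w p = 0))
    (t₂ := B.filter (fun p => affFun w p = 0))
    (Finset.filter_subset_filter _ hAX) (Finset.filter_subset_filter _ hBX)
  have hz : z ∈ convexHull ℝ
      (((A.filter (fun p => affFun w p = 0) : Finset _) : Set (EuclideanSpace ℝ (Fin d))) ∩
      ((B.filter (fun p => affFun w p = 0) : Finset _) : Set (EuclideanSpace ℝ (Fin d)))) := by
    rw [hintg]; exact ⟨h1, h2⟩
  have hempty : (((A.filter (fun p => affFun w p = 0) : Finset _) :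
      Set (EuclideanSpace ℝ (Fin d))) ∩
      ((B.filter (fun p => affFun w p = 0) : Finset _) : Set (EuclideanSpace ℝ (Fin d)))) = ∅ := by
    ext p
    simp only [Finset.coe_filter, Set.mem_inter_iff, Set.mem_setOf_eq, Set.mem_empty_iff_false,
      iff_false]
    rintro ⟨⟨hp, _⟩, hp', _⟩
    exact Finset.disjoint_left.1 hAB hp hp'
  rw [hempty, convexHull_empty] at hz
  exact hz

lemma card_three {α : Type*} (S : Finset α) (f : α → ℝ) :
    (S.filter (fun p => 0 < f p)).card + (S.filter (fun p => f p < 0)).card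
      + (S.filter (fun p => f p = 0)).card = S.card := by
  simp only [Finset.card_filter]
  rw [← Finset.sum_add_distrib, ← Finset.sum_add_distrib, Finset.card_eq_sum_ones]
  refine Finset.sum_congr rfl fun p _ => ?_
  rcases lt_trichotomy (f p) 0 with h | h | h
  · simp [h, h.not_gt, h.ne]
  · simp [h]
  · simp [h, h.not_gt, h.ne']

/-- A hyperplane through exactly one point of every colour that nearly bisects every colour. -/
lemma rainbow_bisector {d : ℕ} (hd : 1 ≤ d) (X : Finset (EuclideanSpace ℝ (Fin d)))
    (C : Fin d → Finset (EuclideanSpace ℝ (Fin d)))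
    (hdisj : ∀ c c' : Fin d, c ≠ c' → Disjoint (C c) (C c'))
    (hunion : Finset.univ.biUnion C = X)
    (hne : ∀ c, 1 ≤ (C c).card)
    (hgp : GenPos d X) :
    ∃ (w : ℝ × (Fin d → ℝ)) (y : Fin d → EuclideanSpace ℝ (Fin d)), w.2 ≠ 0 ∧
      (∀ c, y c ∈ C c) ∧ (∀ c, ∀ p ∈ C c, affFun w p = 0 ↔ p = y c) ∧
      (∀ c, ((C c).filter (fun p => 0 < affFun w p)).card
          + ((C c).filter (fun p => affFun w p < 0)).card + 1 = (C c).card) ∧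
      (∀ c, ((C c).filter (fun p => 0 < affFun w p)).card ≤
          ((C c).filter (fun p => affFun w p < 0)).card + 1 ∧
        ((C c).filter (fun p => affFun w p < 0)).card ≤
          ((C c).filter (fun p => 0 < affFun w p)).card + 1) := by
  have hex : ∀ c, ∃ C' ⊆ C c, Odd C'.card ∧ (C c).card ≤ C'.card + 1 := by
    intro c
    by_cases h : Odd (C c).card
    · exact ⟨C c, subset_rfl, h, Nat.le_succ _⟩
    · obtain ⟨x, hx⟩ := Finset.card_pos.1 (hne c)
      refine ⟨(C c).erase x, Finset.erase_subset _ _, ?_, ?_⟩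
      · rw [Finset.card_erase_of_mem hx]
        rw [Nat.not_odd_iff_even] at h
        exact Nat.Even.sub_odd (hne c) h odd_one
      · rw [Finset.card_erase_of_mem hx]; omega
  choose C' hC' hodd hcard using hex
  obtain ⟨w, hw1, hw2⟩ := discrete_ham_sandwich d C'
  have h3 := fun c => card_three (C' c) (affFun w)
  have hw0 : w.2 ≠ 0 := by
    intro h0
    have haff : ∀ p, affFun w p = w.1 := by intro p; simp [affFun, h0]
    let c : Fin d := ⟨0, hd⟩
    have hb := hw2 c
    have ho := (hodd c).pos
    simp only [h0, Pi.zero_apply] at hw1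
    have hw1' : w.1 ≠ 0 := by
      intro h; rw [h] at hw1; simp at hw1
    simp only [haff] at hb
    rcases lt_or_gt_of_ne hw1' with h | h
    · simp [h, h.ne, h.not_gt] at hb
      simp [hb] at ho
    · simp [h, h.ne', h.not_gt] at hb
      simp [hb] at ho
  have hy : ∀ c, ∃ p ∈ C' c, affFun w p = 0 := by
    intro c
    by_contra hcon
    push Not at hcon
    have hz : ((C' c).filter (fun p => affFun w p = 0)).card = 0 := by
      rw [Finset.card_eq_zero, Finset.filter_eq_empty_iff]
      exact fun p hp => hcon p hp
    have := h3 c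
    have hb := hw2 c
    obtain ⟨k, hk⟩ := hodd c
    omega
  choose y hyC hy0 using hy
  have hyinj : Function.Injective y := by
    intro c c' h
    by_contra hcc
    have h1 := hC' c (hyC c)
    have h2 := hC' c' (hyC c')
    rw [h] at h1
    exact Finset.disjoint_left.1 (hdisj c c' hcc) h1 h2
  have hCX : ∀ c, C c ⊆ X := by
    intro c; rw [← hunion]; exact Finset.subset_biUnion_of_mem C (Finset.mem_univ c)
  have himg : Finset.univ.image y = X.filter (fun p => affFun w p = 0) := by
    apply Finset.eq_of_subset_of_card_le
    · intro p hp
      obtain ⟨c, _, rfl⟩ := Finset.mem_image.1 hp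
      exact Finset.mem_filter.2 ⟨hCX c (hC' c (hyC c)), hy0 c⟩
    · rw [Finset.card_image_of_injective _ hyinj, Finset.card_univ, Fintype.card_fin]
      exact card_on_hyperplane X hgp w hw0
  have hzero : ∀ c, ∀ p ∈ C c, affFun w p = 0 ↔ p = y c := by
    intro c p hp
    constructor
    · intro h
      have : p ∈ Finset.univ.image y := by
        rw [himg]; exact Finset.mem_filter.2 ⟨hCX c hp, h⟩
      obtain ⟨c', _, hc'⟩ := Finset.mem_image.1 this
      by_cases hcc : c' = c
      · rw [← hc', hcc]
      · exfalso
        have h1 := hC' c' (hyC c')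
        rw [hc'] at h1
        exact Finset.disjoint_left.1 (hdisj c' c hcc) h1 hp
    · rintro rfl; exact hy0 c
  have hz1 : ∀ c, (C c).filter (fun p => affFun w p = 0) = {y c} := by
    intro c
    ext p
    simp only [Finset.mem_filter, Finset.mem_singleton]
    constructor
    · rintro ⟨h1, h2⟩; exact (hzero c p h1).1 h2
    · rintro rfl; exact ⟨hC' c (hyC c), hy0 c⟩
  have hz2 : ∀ c, (C' c).filter (fun p => affFun w p = 0) = {y c} := by
    intro c
    ext p
    simp only [Finset.mem_filter, Finset.mem_singleton]
    constructor
    · rintro ⟨h1, h2⟩; exact (hzero c p (hC' c h1)).1 h2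
    · rintro rfl; exact ⟨hyC c, hy0 c⟩
  refine ⟨w, y, hw0, fun c => hC' c (hyC c), hzero, ?_, ?_⟩
  · intro c
    have := card_three (C c) (affFun w)
    rwa [hz1, Finset.card_singleton] at this
  · intro c
    have e1 := card_three (C c) (affFun w)
    have e2 := h3 c
    have e3 := hw2 c
    have hp : ((C' c).filter (fun p => 0 < affFun w p)).card ≤
        ((C c).filter (fun p => 0 < affFun w p)).card :=
      Finset.card_le_card (Finset.filter_subset_filter _ (hC' c))
    have hq : ((C' c).filter (fun p => affFun w p < 0)).card ≤
        ((C c).filter (fun p => affFun w p < 0)).card :=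
      Finset.card_le_card (Finset.filter_subset_filter _ (hC' c))
    rw [hz1, Finset.card_singleton] at e1
    rw [hz2, Finset.card_singleton] at e2 e3
    obtain ⟨k, hk⟩ := hodd c
    have := hcard c
    omega

lemma exists_between_sum {d : ℕ} (L U : Fin d → ℕ) (hLU : ∀ c, L c ≤ U c) (t : ℕ)
    (h1 : ∑ c, L c ≤ t) (h2 : t ≤ ∑ c, U c) :
    ∃ a : Fin d → ℕ, (∀ c, L c ≤ a c ∧ a c ≤ U c) ∧ ∑ c, a c = t := by
  induction t, h1 using Nat.le_induction with
  | base => exact ⟨L, fun c => ⟨le_rfl, hLU c⟩, rfl⟩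
  | succ t _ ih =>
    obtain ⟨a, ha, hsum⟩ := ih (by omega)
    obtain ⟨c, _, hc⟩ : ∃ c ∈ Finset.univ, a c < U c := by
      apply Finset.exists_lt_of_sum_lt
      omega
    refine ⟨fun c' => a c' + (if c' = c then 1 else 0), ?_, ?_⟩
    · intro c'
      have := ha c'
      dsimp only
      split_ifs with h
      · subst h; omega
      · omega
    · rw [Finset.sum_add_distrib, hsum]; simp

lemma numeric_choice {d n : ℕ} (P Q c : Fin d → ℕ) (hc : ∀ i, P i + Q i + 1 = c i)
    (hpq : ∀ i, P i ≤ Q i + 1 ∧ Q i ≤ P i + 1) (hn : ∀ i, n ≤ c i)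
    (hsum : ∑ i, c i = (d + 1) * n) (hle : ∑ i, P i ≤ ∑ i, Q i) :
    ∃ a : Fin d → ℕ, (∀ i, (a i = P i ∨ a i = P i + 1) ∧ n / 2 ≤ a i ∧ a i + (n - n / 2) ≤ c i) ∧
      ∑ i, a i = (d + 1) * (n / 2) := by
  have hmain : ∃ a : Fin d → ℕ, (∀ i, max (P i) (n / 2) ≤ a i ∧
      a i ≤ min (P i + 1) (c i - (n - n / 2))) ∧ ∑ i, a i = (d + 1) * (n / 2) := by
    have hsumPQ : ∑ i, P i + ∑ i, Q i + d = (d + 1) * n := by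
      rw [← hsum, ← Finset.sum_congr rfl (fun i _ => hc i), Finset.sum_add_distrib,
        Finset.sum_add_distrib]
      simp
    apply exists_between_sum
    · intro i
      have := hc i; have := hpq i; have := hn i
      omega
    · rcases Nat.even_or_odd' n with ⟨k, hk | hk⟩
      · have hk2 : n / 2 = k := by omega
        have : 2 * ∑ i, max (P i) (n / 2) ≤ ∑ i, c i := by
          rw [Finset.mul_sum]
          refine Finset.sum_le_sum fun i _ => ?_
          have := hc i; have := hpq i; have := hn i
          omega
        rw [hsum] at this
        have e : (d + 1) * n = 2 * ((d + 1) * k) := by rw [hk]; ring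
        rw [hk2] at *
        omega
      · have hk2 : n / 2 = k := by omega
        have : ∑ i, max (P i) (n / 2) = ∑ i, P i := by
          refine Finset.sum_congr rfl fun i _ => ?_
          have := hc i; have := hpq i; have := hn i
          omega
        rw [this, hk2]
        rw [hk] at hsumPQ
        have e : (d + 1) * (2 * k + 1) = 2 * ((d + 1) * k) + d + 1 := by ring
        omega
    · rcases Nat.even_or_odd' n with ⟨k, hk | hk⟩
      · have hk2 : n / 2 = k := by omega
        have : ∑ i, c i ≤ 2 * ∑ i, min (P i + 1) (c i - (n - n / 2)) := by
          rw [Finset.mul_sum]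
          refine Finset.sum_le_sum fun i _ => ?_
          have := hc i; have := hpq i; have := hn i
          omega
        rw [hsum] at this
        have e : (d + 1) * n = 2 * ((d + 1) * k) := by rw [hk]; ring
        rw [hk2] at *
        omega
      · have hk2 : n / 2 = k := by omega
        have : ∑ i, c i ≤ 2 * ∑ i, min (P i + 1) (c i - (n - n / 2)) + d := by
          have h1 : ∑ i, c i ≤ ∑ i : Fin d, (2 * min (P i + 1) (c i - (n - n / 2)) + 1) := by
            refine Finset.sum_le_sum fun i _ => ?_
            have := hc i; have := hpq i; have := hn i
            omega
          rw [Finset.sum_add_distrib, ← Finset.mul_sum] at h1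
          simpa using h1
        rw [hsum] at this
        have e : (d + 1) * n = 2 * ((d + 1) * k) + d + 1 := by rw [hk]; ring
        rw [hk2] at *
        omega
  obtain ⟨a, ha, hs⟩ := hmain
  refine ⟨a, fun i => ?_, hs⟩
  have := ha i; have := hc i; have := hn i; have := hpq i
  omega

lemma split_step {d n : ℕ} (hd : 1 ≤ d) (hn : 1 ≤ n) (X : Finset (EuclideanSpace ℝ (Fin d)))
    (C : Fin d → Finset (EuclideanSpace ℝ (Fin d)))
    (hdisj : ∀ c c' : Fin d, c ≠ c' → Disjoint (C c) (C c'))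
    (hunion : Finset.univ.biUnion C = X)
    (hcard : X.card = (d + 1) * n)
    (hcolor : ∀ c, n ≤ (C c).card)
    (hgp : GenPos d X) :
    ∃ A ⊆ X, (∀ c, n / 2 ≤ (A ∩ C c).card) ∧ (∀ c, n - n / 2 ≤ ((X \ A) ∩ C c).card) ∧
      A.card = (d + 1) * (n / 2) ∧
      Disjoint (convexHull ℝ (A : Set (EuclideanSpace ℝ (Fin d))))
        (convexHull ℝ ((X \ A : Finset _) : Set (EuclideanSpace ℝ (Fin d)))) := by
  classical
  have hC1 : ∀ c, 1 ≤ (C c).card := fun c => hn.trans (hcolor c)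
  obtain ⟨w, y, hw0, hyC, hzero, hsum, hpq, hle⟩ :
      ∃ (w : ℝ × (Fin d → ℝ)) (y : Fin d → EuclideanSpace ℝ (Fin d)), w.2 ≠ 0 ∧
      (∀ c, y c ∈ C c) ∧ (∀ c, ∀ p ∈ C c, affFun w p = 0 ↔ p = y c) ∧
      (∀ c, ((C c).filter (fun p => 0 < affFun w p)).card
          + ((C c).filter (fun p => affFun w p < 0)).card + 1 = (C c).card) ∧
      (∀ c, ((C c).filter (fun p => 0 < affFun w p)).card ≤
          ((C c).filter (fun p => affFun w p < 0)).card + 1 ∧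
        ((C c).filter (fun p => affFun w p < 0)).card ≤
          ((C c).filter (fun p => 0 < affFun w p)).card + 1) ∧
      ∑ c, ((C c).filter (fun p => 0 < affFun w p)).card ≤
        ∑ c, ((C c).filter (fun p => affFun w p < 0)).card := by
    obtain ⟨w, y, h1, h2, h3, h4, h5⟩ := rainbow_bisector hd X C hdisj hunion hC1 hgp
    rcases le_total (∑ c, ((C c).filter (fun p => 0 < affFun w p)).card)
        (∑ c, ((C c).filter (fun p => affFun w p < 0)).card) with h | h
    · exact ⟨w, y, h1, h2, h3, h4, h5, h⟩
    · refine ⟨-w, y, ?_, h2, ?_, ?_, ?_, ?_⟩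
      · simpa using h1
      · simpa only [affFun_neg, neg_eq_zero] using h3
      · intro c
        simp only [affFun_neg, Left.neg_pos_iff, Left.neg_neg_iff]
        have := h4 c
        omega
      · intro c
        simp only [affFun_neg, Left.neg_pos_iff, Left.neg_neg_iff]
        exact ⟨(h5 c).2, (h5 c).1⟩
      · simpa only [affFun_neg, Left.neg_pos_iff, Left.neg_neg_iff] using h
  have hCsum : ∑ c, (C c).card = (d + 1) * n := by
    rw [← hcard, ← hunion, Finset.card_biUnion]
    intro c _ c' _ h
    exact hdisj c c' h
  obtain ⟨a, ha, hasum⟩ := numeric_choice _ _ _ hsum hpq hcolor hCsum hle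
  let A := X.filter (fun p => 0 < affFun w p ∨ ∃ c, p = y c ∧
    a c = ((C c).filter (fun p => 0 < affFun w p)).card + 1)
  have hCX : ∀ c, C c ⊆ X := by
    intro c; rw [← hunion]; exact Finset.subset_biUnion_of_mem C (Finset.mem_univ c)
  have hy0 : ∀ c, affFun w (y c) = 0 := fun c => (hzero c _ (hyC c)).2 rfl
  have hAC : ∀ c, (A ∩ C c).card = a c := by
    intro c
    have huniq : ∀ c', y c' ∈ C c → c' = c := by
      intro c' h
      by_contra hne
      exact Finset.disjoint_left.1 (hdisj c' c hne) (hyC c') h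
    rcases (ha c).1 with h | h
    · have : A ∩ C c = (C c).filter (fun p => 0 < affFun w p) := by
        ext p
        simp only [A, Finset.mem_inter, Finset.mem_filter]
        constructor
        · rintro ⟨⟨_, h1 | ⟨c', rfl, h2⟩⟩, hp⟩
          · exact ⟨hp, h1⟩
          · have := huniq c' hp
            subst this
            omega
        · rintro ⟨hp, h1⟩
          exact ⟨⟨hCX c hp, Or.inl h1⟩, hp⟩
      rw [this, h]
    · have : A ∩ C c = insert (y c) ((C c).filter (fun p => 0 < affFun w p)) := by
        ext p
        simp only [A, Finset.mem_inter, Finset.mem_filter, Finset.mem_insert]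
        constructor
        · rintro ⟨⟨_, h1 | ⟨c', rfl, h2⟩⟩, hp⟩
          · exact Or.inr ⟨hp, h1⟩
          · have := huniq c' hp
            subst this
            exact Or.inl rfl
        · rintro (rfl | ⟨hp, h1⟩)
          · exact ⟨⟨hCX c (hyC c), Or.inr ⟨c, rfl, h⟩⟩, hyC c⟩
          · exact ⟨⟨hCX c hp, Or.inl h1⟩, hp⟩
      rw [this, Finset.card_insert_of_notMem, h]
      simp [hy0]
  have hAX : A ⊆ X := Finset.filter_subset _ _
  refine ⟨A, hAX, ?_, ?_, ?_, ?_⟩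
  · intro c; rw [hAC]; exact (ha c).2.1
  · intro c
    have h1 : ((X \ A) ∩ C c) = C c \ (A ∩ C c) := by
      ext p
      simp only [Finset.mem_inter, Finset.mem_sdiff]
      constructor
      · rintro ⟨⟨_, h1⟩, h2⟩; exact ⟨h2, fun h => h1 h.1⟩
      · rintro ⟨h1, h2⟩; exact ⟨⟨hCX c h1, fun h => h2 ⟨h, h1⟩⟩, h1⟩
    rw [h1, Finset.card_sdiff_of_subset Finset.inter_subset_right, hAC]
    have := (ha c).2.2
    omega
  · have h1 : A = Finset.univ.biUnion (fun c => A ∩ C c) := by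
      rw [← Finset.inter_biUnion, hunion, Finset.inter_eq_left.2 hAX]
    rw [h1, Finset.card_biUnion]
    · simp only [hAC, hasum]
    · intro c _ c' _ h
      exact (hdisj c c' h).mono Finset.inter_subset_right Finset.inter_subset_right
  · refine hull_disjoint X A (X \ A) hgp hAX Finset.sdiff_subset Finset.disjoint_sdiff w hw0 ?_ ?_
    · intro p hp
      rcases (Finset.mem_filter.1 hp).2 with h | ⟨c, rfl, _⟩
      · exact h.le
      · rw [hy0]
    · intro p hp
      rw [Finset.mem_sdiff] at hp
      by_contra hc
      exact hp.2 (Finset.mem_filter.2 ⟨hp.1, Or.inl (not_le.1 hc)⟩)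

theorem near_equipartition_d_colors_Rd
    (d n : ℕ) (hd : 2 ≤ d) (hn : 1 ≤ n)
    (X : Finset (EuclideanSpace ℝ (Fin d)))
    (C : Fin d → Finset (EuclideanSpace ℝ (Fin d)))
    (hdisj : ∀ c c' : Fin d, c ≠ c' → Disjoint (C c) (C c'))
    (hunion : Finset.univ.biUnion C = X)
    (hcard : X.card = (d + 1) * n)
    (hcolor : ∀ c, n ≤ (C c).card)
    (hgp : GenPos d X) :
    ∃ Y : Fin n → Finset (EuclideanSpace ℝ (Fin d)),
      (∀ i, Y i ⊆ X) ∧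
      (∀ i, (Y i).card = d + 1) ∧
      (∀ i, ∀ c : Fin d, ((Y i) ∩ C c).Nonempty) ∧
      (∀ i, (X : Set (EuclideanSpace ℝ (Fin d))) ∩ convexHull ℝ ((Y i : Set (EuclideanSpace ℝ (Fin d))))
          = (Y i : Set (EuclideanSpace ℝ (Fin d)))) ∧
      (∀ i j, i ≠ j →
        Disjoint (convexHull ℝ ((Y i : Set (EuclideanSpace ℝ (Fin d)))))
          (convexHull ℝ ((Y j : Set (EuclideanSpace ℝ (Fin d)))))) := by
  induction n using Nat.strong_induction_on generalizing X C with
  | _ n ih =>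
    have hCX : ∀ c, C c ⊆ X := by
      intro c; rw [← hunion]; exact Finset.subset_biUnion_of_mem C (Finset.mem_univ c)
    rcases Nat.lt_or_ge n 2 with hlt | hge
    · have hn1 : n = 1 := by omega
      subst hn1
      refine ⟨fun _ => X, fun _ => subset_rfl, fun _ => by rw [hcard, mul_one], ?_, ?_, ?_⟩
      · intro _ c
        rw [Finset.inter_eq_right.2 (hCX c)]
        exact Finset.card_pos.1 (hcolor c)
      · intro _
        exact Set.inter_eq_left.2 (subset_convexHull ℝ _)
      · intro i j hij
        exact absurd (Subsingleton.elim i j) hij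
    · obtain ⟨A, hAX, hA, hB, hAcard, hAB⟩ :=
        split_step (by omega) hn X C hdisj hunion hcard hcolor hgp
      obtain ⟨B, hBdef⟩ : ∃ B, B = X \ A := ⟨_, rfl⟩
      rw [← hBdef] at hAB
      simp only [← hBdef] at hB
      have hBX : B ⊆ X := by rw [hBdef]; exact Finset.sdiff_subset
      have hBcard : B.card = (d + 1) * (n - n / 2) := by
        rw [hBdef, Finset.card_sdiff_of_subset hAX, hcard, hAcard, Nat.mul_sub]
      have hunion' : ∀ S ⊆ X, Finset.univ.biUnion (fun c => S ∩ C c) = S := by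
        intro S hS
        rw [← Finset.inter_biUnion, hunion, Finset.inter_eq_left.2 hS]
      have hdisj' : ∀ S : Finset (EuclideanSpace ℝ (Fin d)), ∀ c c' : Fin d, c ≠ c' →
          Disjoint (S ∩ C c) (S ∩ C c') := fun S c c' h =>
        (hdisj c c' h).mono Finset.inter_subset_right Finset.inter_subset_right
      have hgp' : ∀ S ⊆ X, GenPos d S := fun S hS T hT => hgp T (hT.trans hS)
      obtain ⟨YA, a1, a2, a3, a4, a5⟩ := ih (n / 2) (by omega) (by omega) A (fun c => A ∩ C c)
        (hdisj' A) (hunion' A hAX) hAcard hA (hgp' A hAX)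
      obtain ⟨YB, b1, b2, b3, b4, b5⟩ := ih (n - n / 2) (by omega) (by omega) B
        (fun c => B ∩ C c) (hdisj' B) (hunion' B hBX) hBcard hB (hgp' B hBX)
      have isl : ∀ (S T Z : Finset (EuclideanSpace ℝ (Fin d))), S ⊆ X → (∀ p ∈ X, p ∈ S ∨ p ∈ T) →
          Disjoint (convexHull ℝ (S : Set (EuclideanSpace ℝ (Fin d))))
            (convexHull ℝ (T : Set (EuclideanSpace ℝ (Fin d)))) → Z ⊆ S →
          (S : Set (EuclideanSpace ℝ (Fin d))) ∩ convexHull ℝ (Z : Set (EuclideanSpace ℝ (Fin d)))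
            = (Z : Set (EuclideanSpace ℝ (Fin d))) →
          (X : Set (EuclideanSpace ℝ (Fin d))) ∩ convexHull ℝ (Z : Set (EuclideanSpace ℝ (Fin d)))
            = (Z : Set (EuclideanSpace ℝ (Fin d))) := by
        intro S T Z hSX hcov hST hZS hisl
        apply Set.Subset.antisymm
        · rintro p ⟨hp, hpZ⟩
          rcases hcov p hp with h | h
          · rw [← hisl]; exact ⟨h, hpZ⟩
          · exfalso
            exact Set.disjoint_left.1 hST (convexHull_mono (by exact_mod_cast hZS) hpZ)
              (subset_convexHull ℝ _ h)
        · intro p hp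
          exact ⟨hSX (hZS hp), subset_convexHull ℝ _ hp⟩
      have hcov : ∀ p ∈ X, p ∈ A ∨ p ∈ B := by
        intro p hp
        by_cases h : p ∈ A
        · exact Or.inl h
        · right; rw [hBdef]; exact Finset.mem_sdiff.2 ⟨hp, h⟩
      have hcross : ∀ i j, Disjoint (convexHull ℝ (YA i : Set (EuclideanSpace ℝ (Fin d))))
          (convexHull ℝ (YB j : Set (EuclideanSpace ℝ (Fin d)))) := fun i j =>
        hAB.mono (convexHull_mono (by exact_mod_cast a1 i)) (convexHull_mono (by exact_mod_cast b1 j))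
      let e : Fin n ≃ Fin (n / 2) ⊕ Fin (n - n / 2) :=
        (finCongr (by omega : n = n / 2 + (n - n / 2))).trans finSumFinEquiv.symm
      refine ⟨fun i => Sum.elim YA YB (e i), ?_, ?_, ?_, ?_, ?_⟩
      · intro i
        rcases h : e i with j | j
        · simpa [h] using (a1 j).trans hAX
        · simpa [h] using (b1 j).trans hBX
      · intro i
        rcases h : e i with j | j
        · simpa [h] using a2 j
        · simpa [h] using b2 j
      · intro i c
        rcases h : e i with j | j
        · simp only [h, Sum.elim_inl]
          exact (a3 j c).mono (Finset.inter_subset_inter_left Finset.inter_subset_right)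
        · simp only [h, Sum.elim_inr]
          exact (b3 j c).mono (Finset.inter_subset_inter_left Finset.inter_subset_right)
      · intro i
        rcases h : e i with j | j
        · simp only [h, Sum.elim_inl]
          exact isl A B (YA j) hAX hcov hAB (a1 j) (a4 j)
        · simp only [h, Sum.elim_inr]
          exact isl B A (YB j) hBX (fun p hp => (hcov p hp).symm) hAB.symm (b1 j) (b4 j)
      · intro i i' hii
        have hne : e i ≠ e i' := fun h => hii (e.injective h)
        rcases h : e i with j | j <;> rcases h' : e i' with j' | j' <;>
          simp only [h, h', Sum.elim_inl, Sum.elim_inr]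
        · exact a5 j j' (fun hj => hne (by rw [h, h', hj]))
        · exact hcross j j'
        · exact (hcross j' j).symm
        · exact b5 j j' (fun hj => hne (by rw [h, h', hj]))
end

section
/- Let d ≥ 2 and n ≥ 2 be integers. Let X₁, X₂, …, X_d ⊂ ℝ^d be d pairwise disjoint finite point sets that are balanced in ℝ^d, such that X₁ ∪ X₂ ∪ … ∪ X_d is in general position and Σ_{i=1}^{d} |X_i| = (d+1)n. Then there exists a hyperplane h = {x ∈ ℝ^d : ⟨x, v⟩ = c} (with v ≠ 0) containing no point of X₁ ∪ … ∪ X_d, such that for each of the two open halfspaces H determined by h (namely {x : ⟨x, v⟩ > c} and {x : ⟨x, v⟩ < c}), the sets X₁, X₂, …, X_d are balanced in H and Σ_{i=1}^{d} |H ∩ X_i| is a positive integer multiple of d + 1. -/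
open RealInnerProductSpace

namespace HS
set_option linter.unusedSectionVars false
set_option linter.unusedVariables false
open Finset

section
variable {d : ℕ} {ι : Type*} [Fintype ι] [DecidableEq ι]

/-- Determinant of the vectors indexed by `e`. -/
noncomputable def chi (v : ι → Fin (d+1) → ℝ) (e : Fin (d+1) → ι) : ℝ :=
  Matrix.det (Matrix.of fun k => v (e k))

noncomputable def sg (r : ℝ) : ℤ := ((SignType.sign r : SignType) : ℤ)

lemma sg_zero : sg 0 = 0 := by simp [sg]
lemma sg_neg (r : ℝ) : sg (-r) = - sg r := by
  simp [sg, Left.sign_neg]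
lemma sg_mul (r t : ℝ) : sg (r * t) = sg r * sg t := by
  simp [sg, sign_mul]
lemma sg_pos {r : ℝ} (h : 0 < r) : sg r = 1 := by simp [sg, sign_pos h]
lemma sg_of_neg {r : ℝ} (h : r < 0) : sg r = -1 := by simp [sg, _root_.sign_neg h]
lemma sg_cases {r : ℝ} (h : r ≠ 0) : sg r = 1 ∨ sg r = -1 := by
  rcases lt_or_gt_of_ne h with h | h
  · right; exact sg_of_neg h
  · left; exact sg_pos h
lemma sg_eq_zero {r : ℝ} : sg r = 0 ↔ r = 0 := by
  constructor
  · intro h; by_contra h'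
    rcases sg_cases h' with h1 | h1 <;> omega
  · rintro rfl; exact sg_zero

/-- Signed count of colour class `i` with respect to the hyperplane spanned by `s`. -/
noncomputable def bal (S : Finset ι) (col : ι → Fin d) (v : ι → Fin (d+1) → ℝ)
    (s : Fin d → ι) (i : Fin d) : ℤ :=
  ∑ j ∈ S.filter (fun j => col j = i), sg (chi v (Fin.cons j s : Fin (d+1) → ι))

def Tr (S : Finset ι) (col : ι → Fin d) (s : Fin d → ι) : Prop :=
  ∀ i, s i ∈ S ∧ col (s i) = i

def Good (S : Finset ι) (col : ι → Fin d) (v : ι → Fin (d+1) → ℝ) (s : Fin d → ι) : Prop :=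
  Tr S col s ∧ ∀ i, bal S col v s i = 0

open Classical in
noncomputable def N (S : Finset ι) (col : ι → Fin d) (v : ι → Fin (d+1) → ℝ) : ℕ :=
  (univ.filter (Good S col v)).card

lemma even_invol {α : Type*} [DecidableEq α] (D : Finset α) (g : α → α)
    (hm : ∀ x ∈ D, g x ∈ D) (hne : ∀ x ∈ D, g x ≠ x) (hi : ∀ x ∈ D, g (g x) = x) :
    ((D.card : ℕ) : ZMod 2) = 0 := by
  have : ∑ x ∈ D, (1 : ZMod 2) = 0 := by
    refine Finset.sum_involution (fun x _ => g x) ?_ ?_ ?_ ?_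
    · intros; decide
    · intro a ha _; exact hne a ha
    · intro a ha; exact hm a ha
    · intro a ha; exact hi a ha
  simpa using this

open Classical in
lemma parity_invol {α : Type*} [Fintype α] (P Q : α → Prop) (g : α → α)
    (hm : ∀ x, ¬ (P x ↔ Q x) → ¬ (P (g x) ↔ Q (g x)) ∧ g x ≠ x ∧ g (g x) = x) :
    ((univ.filter P).card : ZMod 2) = ((univ.filter Q).card : ZMod 2) := by
  have h := even_invol (univ.filter fun x => ¬ (P x ↔ Q x)) g
    (by intro x hx; simp only [mem_filter, mem_univ, true_and] at hx ⊢; exact (hm x hx).1)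
    (by intro x hx; simp only [mem_filter, mem_univ, true_and] at hx; exact (hm x hx).2.1)
    (by intro x hx; simp only [mem_filter, mem_univ, true_and] at hx; exact (hm x hx).2.2)
  have e : ((univ.filter P).card : ZMod 2) + ((univ.filter Q).card : ZMod 2)
      = ((univ.filter fun x => ¬ (P x ↔ Q x)).card : ZMod 2) := by
    simp only [Finset.card_filter]
    push_cast
    rw [← Finset.sum_add_distrib]
    refine Finset.sum_congr rfl fun x _ => ?_
    by_cases h1 : P x <;> by_cases h2 : Q x <;> simp [h1, h2]
    decide
  rw [h] at e
  have := eq_neg_of_add_eq_zero_left e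
  rw [this, ZMod.neg_eq_self_mod_two]

lemma chi_congr {v v' : ι → Fin (d+1) → ℝ} {e : Fin (d+1) → ι}
    (h : ∀ k, v (e k) = v' (e k)) : chi v e = chi v' e := by
  unfold chi; congr 1; ext k l; simp [h]

lemma chi_eq_zero_of_not_inj (v : ι → Fin (d+1) → ℝ) (e : Fin (d+1) → ι)
    (h : ¬ Function.Injective e) : chi v e = 0 := by
  simp only [Function.Injective, not_forall] at h
  obtain ⟨a, b, hab, hne⟩ := h
  exact Matrix.det_zero_of_row_eq hne (by ext l; simp [hab])

lemma chi_perm (v : ι → Fin (d+1) → ℝ) (e : Fin (d+1) → ι) (σ : Equiv.Perm (Fin (d+1))) :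
    chi v (e ∘ σ) = (Equiv.Perm.sign σ : ℤ) * chi v e := by
  unfold chi
  exact Matrix.det_permute σ (Matrix.of fun k => v (e k))

lemma chi_image (v : ι → Fin (d+1) → ℝ) {e e' : Fin (d+1) → ι} (he : Function.Injective e)
    (h : univ.image e = univ.image e') (he' : Function.Injective e') :
    chi v e = 0 → chi v e' = 0 := by
  intro h0
  have hr : ∀ k, ∃ l, e l = e' k := by
    intro k
    have : e' k ∈ univ.image e := by rw [h]; simp
    simpa using this
  choose f hf using hr
  have hfi : Function.Injective f := by
    intro a b hab
    apply he'
    rw [← hf a, ← hf b, hab]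
  have hb := Finite.injective_iff_bijective.1 hfi
  have : e' = e ∘ (Equiv.ofBijective f hb) := by
    ext k; simp [hf]
  rw [this, chi_perm, h0, mul_zero]

lemma cons_inj {s : Fin d → ι} (hs : Function.Injective s) {j : ι} (hj : ∀ i, s i ≠ j) :
    Function.Injective (Fin.cons j s : Fin (d+1) → ι) := by
  rw [Fin.cons_injective_iff]
  exact ⟨by rintro ⟨i, hi⟩; exact hj i hi, hs⟩

lemma chi_cons_self (v : ι → Fin (d+1) → ℝ) (s : Fin d → ι) (i : Fin d) :
    chi v (Fin.cons (s i) s : Fin (d+1) → ι) = 0 := by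
  apply chi_eq_zero_of_not_inj
  intro h
  have := @h 0 i.succ (by simp)
  exact (Fin.succ_ne_zero i) this.symm

lemma chi_swap (v : ι → Fin (d+1) → ℝ) (s : Fin d → ι) (c : Fin d) (u : ι) :
    chi v (Fin.cons (s c) (Function.update s c u) : Fin (d+1) → ι)
      = - chi v (Fin.cons u s : Fin (d+1) → ι) := by
  have : (Fin.cons (s c) (Function.update s c u) : Fin (d+1) → ι)
      = (Fin.cons u s : Fin (d+1) → ι) ∘ (Equiv.swap 0 c.succ) := by
    ext k
    refine Fin.cases ?_ (fun i => ?_) k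
    · simp
    · by_cases h : i = c
      · subst h; simp
      · have : Equiv.swap 0 c.succ i.succ = i.succ :=
          Equiv.swap_apply_of_ne_of_ne (Fin.succ_ne_zero i) (by simpa using h)
        simp [this, h]
  rw [this, chi_perm, Equiv.Perm.sign_swap (Fin.succ_ne_zero c).symm]
  simp

/-- the linear functional `x ↦ det (x, v (s 0), ...)` -/
noncomputable def fn (v : ι → Fin (d+1) → ℝ) (s : Fin d → ι) : (Fin (d+1) → ℝ) →ₗ[ℝ] ℝ :=
  (Matrix.detRowAlternating (n := Fin (d+1)) (R := ℝ)).toMultilinearMap.toLinearMap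
    (Fin.cons 0 (fun i => v (s i))) 0

lemma fn_apply (v : ι → Fin (d+1) → ℝ) (s : Fin d → ι) (j : ι) :
    fn v s (v j) = chi v (Fin.cons j s : Fin (d+1) → ι) := by
  unfold fn chi
  simp only [MultilinearMap.toLinearMap_apply, Fin.update_cons_zero]
  show Matrix.det _ = _
  congr 1
  ext k l
  refine Fin.cases ?_ (fun i => ?_) k <;> simp

lemma span_of_chi_ne (v : ι → Fin (d+1) → ℝ) (e : Fin (d+1) → ι) (h : chi v e ≠ 0) :
    LinearIndependent ℝ (fun k => v (e k)) := by
  have : IsUnit (Matrix.of fun k => v (e k)) := by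
    rw [Matrix.isUnit_iff_isUnit_det]; exact isUnit_iff_ne_zero.2 h
  exact Matrix.linearIndependent_rows_iff_isUnit.2 this

noncomputable def bas (v : ι → Fin (d+1) → ℝ) (e : Fin (d+1) → ι) (h : chi v e ≠ 0) :
    Module.Basis (Fin (d+1)) ℝ (Fin (d+1) → ℝ) :=
  basisOfLinearIndependentOfCardEqFinrank (span_of_chi_ne v e h) (by simp)

lemma bas_apply (v : ι → Fin (d+1) → ℝ) (e : Fin (d+1) → ι) (h : chi v e ≠ 0) (k) :
    bas v e h k = v (e k) := by
  simp [bas]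

lemma proportional (v : ι → Fin (d+1) → ℝ) (s : Fin d → ι) (c : Fin d) (u : ι)
    (h0 : chi v (Fin.cons u s : Fin (d+1) → ι) = 0) (k : ι)
    (hk : chi v (Fin.cons k s : Fin (d+1) → ι) ≠ 0) (j : ι) :
    chi v (Fin.cons j (Function.update s c u) : Fin (d+1) → ι) * chi v (Fin.cons k s : Fin (d+1) → ι)
    = chi v (Fin.cons k (Function.update s c u) : Fin (d+1) → ι) * chi v (Fin.cons j s : Fin (d+1) → ι) := by
  have : (chi v (Fin.cons k s : Fin (d+1) → ι)) • fn v (Function.update s c u)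
      = (chi v (Fin.cons k (Function.update s c u) : Fin (d+1) → ι)) • fn v s := by
    refine (bas v _ hk).ext fun l => ?_
    rw [bas_apply]
    simp only [LinearMap.smul_apply, fn_apply, smul_eq_mul]
    refine Fin.cases ?_ (fun i => ?_) l
    · simp only [Fin.cons_zero]; ring
    · simp only [Fin.cons_succ]
      rw [chi_cons_self v s i, mul_zero]
      by_cases h : i = c
      · subst h
        rw [chi_swap, h0]; simp
      · have : s i = Function.update s c u i := by simp [h]
        rw [this, chi_cons_self, mul_zero]
  have := congrArg (fun L => L (v j)) this
  simp only [LinearMap.smul_apply, fn_apply, smul_eq_mul] at this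
  linarith

lemma Tr.inj {S : Finset ι} {col : ι → Fin d} {s : Fin d → ι} (h : Tr S col s) :
    Function.Injective s := by
  intro a b hab
  rw [← (h a).2, ← (h b).2, hab]

lemma image_cons (j : ι) (s : Fin d → ι) :
    univ.image (Fin.cons j s : Fin (d+1) → ι) = insert j (univ.image s) := by
  ext x
  simp only [mem_image, mem_univ, true_and, mem_insert]
  constructor
  · rintro ⟨k, rfl⟩
    refine Fin.cases ?_ (fun i => ?_) k
    · simp
    · right; exact ⟨i, by simp⟩
  · rintro (rfl | ⟨i, rfl⟩)
    · exact ⟨0, by simp⟩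
    · exact ⟨i.succ, by simp⟩

lemma image_update (s : Fin d → ι) (hs : Function.Injective s) (c : Fin d) (u : ι)
    (hu : ∀ i, s i ≠ u) :
    insert (s c) (univ.image (Function.update s c u)) = insert u (univ.image s) := by
  ext x
  simp only [mem_image, mem_univ, true_and, mem_insert]
  constructor
  · rintro (rfl | ⟨i, rfl⟩)
    · right; exact ⟨c, rfl⟩
    · by_cases h : i = c
      · subst h; simp
      · right; exact ⟨i, by simp [h]⟩
  · rintro (rfl | ⟨i, rfl⟩)
    · right; exact ⟨c, by simp⟩
    · by_cases h : i = c
      · subst h; simp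
      · right; exact ⟨i, by simp [h]⟩

lemma Tr.update {S : Finset ι} {col : ι → Fin d} {s : Fin d → ι} (h : Tr S col s) {u : ι}
    (hu : u ∈ S) : Tr S col (Function.update s (col u) u) := by
  intro i
  by_cases hi : i = col u
  · subst hi; simp [hu]
  · simp [hi, h i]

end
end HS
namespace HS
open Finset
set_option linter.unusedSectionVars false
set_option linter.unusedVariables false
section
variable {d : ℕ} {ι : Type*} [Fintype ι] [DecidableEq ι]

/-- Wall data -/
structure Wall (S : Finset ι) (v0 v : ι → Fin (d+1) → ℝ) (W : Finset ι) : Prop where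
  off : ∀ e : Fin (d+1) → ι, Function.Injective e → (∀ k, e k ∈ S) → univ.image e ≠ W →
    chi v0 e ≠ 0 ∧ sg (chi v e) = sg (chi v0 e)
  on : ∀ e : Fin (d+1) → ι, Function.Injective e → (∀ k, e k ∈ S) → univ.image e = W →
    chi v0 e = 0 ∧ chi v e ≠ 0

lemma cons_mem {S : Finset ι} {s : Fin d → ι} (hs : ∀ i, s i ∈ S) {j : ι} (hj : j ∈ S) :
    ∀ k, (Fin.cons j s : Fin (d+1) → ι) k ∈ S := by
  intro k
  refine Fin.cases ?_ (fun i => ?_) k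
  · simpa
  · simpa using hs i

lemma Wall.sg_eq {S : Finset ι} {v0 v : ι → Fin (d+1) → ℝ} {W : Finset ι} (h : Wall S v0 v W)
    {s : Fin d → ι} (hs : Function.Injective s) (hS : ∀ i, s i ∈ S) {j : ι} (hj : j ∈ S)
    (hW : (∀ i, s i ≠ j) → insert j (univ.image s) ≠ W) :
    sg (chi v (Fin.cons j s : Fin (d+1) → ι)) = sg (chi v0 (Fin.cons j s : Fin (d+1) → ι)) := by
  by_cases h1 : ∀ i, s i ≠ j
  · exact (h.off _ (cons_inj hs h1) (cons_mem hS hj) (by rw [image_cons]; exact hW h1)).2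
  · push Not at h1
    obtain ⟨i, rfl⟩ := h1
    rw [chi_cons_self, chi_cons_self]

lemma Wall.bal_eq_of_not {S : Finset ι} {col : ι → Fin d} {v0 v : ι → Fin (d+1) → ℝ} {W : Finset ι}
    (h : Wall S v0 v W) {s : Fin d → ι} (hs : Tr S col s)
    (hn : ¬ ∃ u ∈ S, (∀ i, s i ≠ u) ∧ insert u (univ.image s) = W) (i : Fin d) :
    bal S col v s i = bal S col v0 s i := by
  unfold bal
  refine Finset.sum_congr rfl fun j hj => ?_
  have hj := (mem_filter.1 hj).1
  exact h.sg_eq hs.inj (fun i => (hs i).1) hj fun h1 h2 => hn ⟨j, hj, h1, h2⟩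

lemma ins_unique {s : Fin d → ι} {W : Finset ι} {u u' : ι}
    (h1 : ∀ i, s i ≠ u) (h2 : insert u (univ.image s) = W)
    (h1' : ∀ i, s i ≠ u') (h2' : insert u' (univ.image s) = W) : u = u' := by
  have : u ∈ insert u' (univ.image s) := by rw [h2', ← h2]; simp
  simp only [mem_insert, mem_image, mem_univ, true_and] at this
  rcases this with h | ⟨i, h⟩
  · exact h
  · exact absurd h (h1 i)

lemma Wall.bal_eq_of {S : Finset ι} {col : ι → Fin d} {v0 v : ι → Fin (d+1) → ℝ} {W : Finset ι}
    (h : Wall S v0 v W) {s : Fin d → ι} (hs : Tr S col s) {u : ι} (hu : u ∈ S)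
    (h1 : ∀ i, s i ≠ u) (h2 : insert u (univ.image s) = W) (i : Fin d) :
    bal S col v s i = bal S col v0 s i +
      (if i = col u then sg (chi v (Fin.cons u s : Fin (d+1) → ι)) else 0) := by
  unfold bal
  have h0 : chi v0 (Fin.cons u s : Fin (d+1) → ι) = 0 :=
    (h.on _ (cons_inj hs.inj h1) (cons_mem (fun i => (hs i).1) hu) (by rw [image_cons]; exact h2)).1
  have key : ∀ j ∈ S, sg (chi v (Fin.cons j s : Fin (d+1) → ι)) =
      sg (chi v0 (Fin.cons j s : Fin (d+1) → ι)) +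
      if j = u then sg (chi v (Fin.cons u s : Fin (d+1) → ι)) else 0 := by
    intro j hj
    by_cases hju : j = u
    · subst hju; simp [h0, sg_zero]
    · rw [if_neg hju, add_zero]
      exact h.sg_eq hs.inj (fun i => (hs i).1) hj fun h1' h2' => hju (ins_unique h1' h2' h1 h2)
  rw [Finset.sum_congr rfl fun j hj => key j (mem_filter.1 hj).1, Finset.sum_add_distrib]
  congr 1
  rw [Finset.sum_ite_eq']
  simp [hu, eq_comm]

lemma wall_kappa {S : Finset ι} {col : ι → Fin d} {v0 v : ι → Fin (d+1) → ℝ} {W : Finset ι}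
    (h : Wall S v0 v W) {s : Fin d → ι} (hs : Tr S col s) {u : ι} (hu : u ∈ S)
    (h1 : ∀ i, s i ≠ u) (h2 : insert u (univ.image s) = W) :
    ∃ κ : ℤ, (κ = 1 ∨ κ = -1) ∧ ∀ i, bal S col v0 (Function.update s (col u) u) i
      = κ * bal S col v0 s i := by
  set c := col u with hc
  set s' := Function.update s c u with hs'
  have hs'T : Tr S col s' := hs.update hu
  have hne' : ∀ i, s' i ≠ s c := by
    intro i
    by_cases hi : i = c
    · subst hi; simpa [hs'] using (h1 c).symm
    · simp only [hs', Function.update_of_ne hi]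
      exact fun h => hi (hs.inj h)
  have h2' : insert (s c) (univ.image s') = W := by rw [hs', image_update s hs.inj c u h1, h2]
  have h0 : chi v0 (Fin.cons u s : Fin (d+1) → ι) = 0 :=
    (h.on _ (cons_inj hs.inj h1) (cons_mem (fun i => (hs i).1) hu) (by rw [image_cons]; exact h2)).1
  have h0' : chi v0 (Fin.cons (s c) s' : Fin (d+1) → ι) = 0 := by rw [hs', chi_swap, h0, neg_zero]
  have hin : ∀ j ∈ W, chi v0 (Fin.cons j s : Fin (d+1) → ι) = 0 ∧
      chi v0 (Fin.cons j s' : Fin (d+1) → ι) = 0 := by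
    intro j hj
    constructor
    · rw [← h2] at hj
      simp only [mem_insert, mem_image, mem_univ, true_and] at hj
      rcases hj with rfl | ⟨i, rfl⟩
      · exact h0
      · exact chi_cons_self _ _ _
    · rw [← h2'] at hj
      simp only [mem_insert, mem_image, mem_univ, true_and] at hj
      rcases hj with rfl | ⟨i, rfl⟩
      · exact h0'
      · exact chi_cons_self _ _ _
  have hout : ∀ (r : Fin d → ι), Tr S col r → ∀ j ∈ S, j ∉ W → (∀ i, r i ∈ W) →
      chi v0 (Fin.cons j r : Fin (d+1) → ι) ≠ 0 := by
    intro r hr j hj hjW hrW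
    refine (h.off _ (cons_inj hr.inj ?_) (cons_mem (fun i => (hr i).1) hj) ?_).1
    · rintro i rfl; exact hjW (hrW i)
    · rw [image_cons]; rintro rfl; simp at hjW
  have hsW : ∀ i, s i ∈ W := by intro i; rw [← h2]; simp
  have hsW' : ∀ i, s' i ∈ W := by intro i; rw [← h2']; simp
  have main : ∃ κ : ℤ, (κ = 1 ∨ κ = -1) ∧ ∀ j ∈ S, sg (chi v0 (Fin.cons j s' : Fin (d+1) → ι)) =
      κ * sg (chi v0 (Fin.cons j s : Fin (d+1) → ι)) := by
    by_cases hex : ∃ k ∈ S, k ∉ W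
    · obtain ⟨k, hk, hkW⟩ := hex
      have ha := hout s hs k hk hkW hsW
      have hb := hout s' hs'T k hk hkW hsW'
      refine ⟨sg (chi v0 (Fin.cons k s' : Fin (d+1) → ι)) * sg (chi v0 (Fin.cons k s : Fin (d+1) → ι)), ?_, ?_⟩
      · rcases sg_cases ha with h | h <;> rcases sg_cases hb with h' | h' <;> simp [h, h']
      · intro j hj
        have hp := congrArg sg (proportional v0 s c u h0 k ha j)
        rw [sg_mul, sg_mul] at hp
        rcases sg_cases ha with h | h <;> rw [h] at hp ⊢ <;> linarith
    · push Not at hex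
      refine ⟨1, Or.inl rfl, fun j hj => ?_⟩
      rw [(hin j (hex j hj)).1, (hin j (hex j hj)).2]; simp
  obtain ⟨κ, hκ, hm⟩ := main
  refine ⟨κ, hκ, fun i => ?_⟩
  unfold bal
  rw [Finset.mul_sum]
  exact Finset.sum_congr rfl fun j hj => hm j (mem_filter.1 hj).1

open Classical in
theorem cross (S : Finset ι) (col : ι → Fin d) (v0 v v' : ι → Fin (d+1) → ℝ) (W : Finset ι)
    (h : Wall S v0 v W) (h' : Wall S v0 v' W) :
    (N S col v : ZMod 2) = (N S col v' : ZMod 2) := by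
  unfold N
  let g : (Fin d → ι) → (Fin d → ι) := fun s =>
    if hx : ∃ u ∈ S, (∀ i, s i ≠ u) ∧ insert u (univ.image s) = W then
      Function.update s (col hx.choose) hx.choose else s
  have hg : ∀ s u, u ∈ S → (∀ i, s i ≠ u) → insert u (univ.image s) = W →
      g s = Function.update s (col u) u := by
    intro s u hu h1 h2
    have hx : ∃ u ∈ S, (∀ i, s i ≠ u) ∧ insert u (univ.image s) = W := ⟨u, hu, h1, h2⟩
    have : hx.choose = u := ins_unique hx.choose_spec.2.1 hx.choose_spec.2.2 h1 h2
    simp only [g, dif_pos hx, this]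
  refine parity_invol (Good S col v) (Good S col v') g ?_
  intro s hs
  have hT : Tr S col s := by
    by_contra hT
    exact hs ⟨fun h => absurd h.1 hT, fun h => absurd h.1 hT⟩
  have hx : ∃ u ∈ S, (∀ i, s i ≠ u) ∧ insert u (univ.image s) = W := by
    by_contra hx
    apply hs
    unfold Good
    simp only [h.bal_eq_of_not hT hx, h'.bal_eq_of_not hT hx]
  obtain ⟨u, hu, h1, h2⟩ := hx
  rw [hg s u hu h1 h2]
  set c := col u with hc
  set s' := Function.update s c u with hs'
  have hs'T : Tr S col s' := hT.update hu
  have hne' : ∀ i, s' i ≠ s c := by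
    intro i
    by_cases hi : i = c
    · subst hi; simpa [hs'] using (h1 c).symm
    · simp only [hs', Function.update_of_ne hi]
      exact fun h => hi (hT.inj h)
  have h2' : insert (s c) (univ.image s') = W := by rw [hs', image_update s hT.inj c u h1, h2]
  have hcol : col (s c) = c := (hT c).2
  refine ⟨?_, ?_, ?_⟩
  · obtain ⟨κ, hκ, hm⟩ := wall_kappa h hT hu h1 h2 (col := col)
    have e1 : ∀ i, bal S col v s i = _ := h.bal_eq_of hT hu h1 h2
    have e2 : ∀ i, bal S col v' s i = _ := h'.bal_eq_of hT hu h1 h2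
    have e3 : ∀ i, bal S col v s' i = _ := h.bal_eq_of hs'T (hT c).1 hne' h2'
    have e4 : ∀ i, bal S col v' s' i = _ := h'.bal_eq_of hs'T (hT c).1 hne' h2'
    have n1 : chi v (Fin.cons u s : Fin (d+1) → ι) ≠ 0 :=
      (h.on _ (cons_inj hT.inj h1) (cons_mem (fun i => (hT i).1) hu) (by rw [image_cons]; exact h2)).2
    have n2 : chi v' (Fin.cons u s : Fin (d+1) → ι) ≠ 0 :=
      (h'.on _ (cons_inj hT.inj h1) (cons_mem (fun i => (hT i).1) hu) (by rw [image_cons]; exact h2)).2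
    rw [hs', chi_swap, sg_neg, ← hs', hcol] at e3 e4
    rw [← hc] at e1 e2
    rw [← hc, ← hs'] at hm
    simp only [hm] at e3 e4
    have sp : ∀ b : Fin d → ℤ, (∀ i, b i = 0) ↔ (b c = 0 ∧ ∀ i, i ≠ c → b i = 0) :=
      fun b => ⟨fun h => ⟨h c, fun i _ => h i⟩, fun h i => by
        by_cases hi : i = c
        · rw [hi]; exact h.1
        · exact h.2 i hi⟩
    have q : ∀ (k ε : ℤ), (k = 1 ∨ k = -1) → ((∀ i, k * bal S col v0 s i + (if i = c then ε else 0) = 0) ↔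
        (k * bal S col v0 s c + ε = 0 ∧ ∀ i, i ≠ c → bal S col v0 s i = 0)) := by
      intro k ε hk
      rw [sp]
      simp only [if_true]
      refine and_congr Iff.rfl (forall_congr' fun i => forall_congr' fun hi => ?_)
      rw [if_neg hi, add_zero]
      rcases hk with rfl | rfl <;> simp
    have q1 := fun ε => q 1 ε (Or.inl rfl)
    simp only [one_mul] at q1
    unfold Good at hs ⊢
    simp only [e1, e2, e3, e4, hT, hs'T, true_and, q1, q κ _ hκ] at hs ⊢
    generalize (∀ i, i ≠ c → bal S col v0 s i = 0) = A at hs ⊢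
    generalize bal S col v0 s c = b at hs ⊢
    rcases sg_cases n1 with h | h <;> rcases sg_cases n2 with h' | h' <;> rw [h, h'] at hs ⊢
    · exact absurd Iff.rfl hs
    · intro h3; apply hs
      by_cases hA : A
      · simp only [hA, and_true] at h3 ⊢; rcases hκ with rfl | rfl <;> omega
      · simp [hA]
    · intro h3; apply hs
      by_cases hA : A
      · simp only [hA, and_true] at h3 ⊢; rcases hκ with rfl | rfl <;> omega
      · simp [hA]
    · exact absurd Iff.rfl hs
  · intro heq
    have := congrFun heq c
    simp only [hs', Function.update_self] at this
    exact h1 c this.symm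
  · rw [hg s' (s c) (hT c).1 hne' h2', hcol, hs']
    simp

/-- If all signs agree then the counts agree. -/
lemma N_congr (S : Finset ι) (col : ι → Fin d) (v v' : ι → Fin (d+1) → ℝ)
    (h : ∀ e : Fin (d+1) → ι, Function.Injective e → (∀ k, e k ∈ S) → sg (chi v e) = sg (chi v' e)) :
    N S col v = N S col v' := by
  unfold N
  congr 1
  ext s
  simp only [mem_filter, mem_univ, true_and]
  unfold Good
  refine and_congr_right fun hT => forall_congr' fun i => ?_
  have : bal S col v s i = bal S col v' s i := by
    unfold bal
    refine Finset.sum_congr rfl fun j hj => ?_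
    have hj := (mem_filter.1 hj).1
    by_cases hi : Function.Injective (Fin.cons j s : Fin (d+1) → ι)
    · exact h _ hi (cons_mem (fun i => (hT i).1) hj)
    · rw [chi_eq_zero_of_not_inj _ _ hi, chi_eq_zero_of_not_inj _ _ hi]
  rw [this]

end
end HS
namespace HS
open Finset
set_option linter.unusedSectionVars false
set_option linter.unusedVariables false
section
variable {d : ℕ} {ι : Type*} [Fintype ι] [DecidableEq ι]

lemma cancel_bal (S : Finset ι) (col : ι → Fin d) (w : ι → Fin (d+1) → ℝ) (a b : ι)
    (ha : a ∈ S) (hb : b ∈ S) (hab : a ≠ b) (hcol : col a = col b)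
    (hneg : ∀ e : Fin (d+1) → ι, Function.Injective e → (∀ k, e k ∈ S) → (∃ k, e k = a) →
      (∀ k, e k ≠ b) → sg (chi w e) = - sg (chi w (Equiv.swap a b ∘ e)))
    (s : Fin d → ι) (hT : Tr S col s) (hs : s (col a) = a) (i : Fin d) :
    bal S col w (Function.update s (col a) b) i = - bal S col w s i := by
  unfold bal
  rw [← Finset.sum_neg_distrib]
  symm
  have hsb : ∀ i, s i ≠ b := by
    intro i h
    have := (hT i).2
    rw [h, ← hcol] at this
    rw [← this, hs] at h
    exact hab h
  refine Finset.sum_equiv (Equiv.swap a b) ?_ ?_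
  · intro j
    simp only [mem_filter]
    by_cases h1 : j = a
    · subst h1; simp [ha, hb, hcol]
    · by_cases h2 : j = b
      · subst h2; simp [ha, hb, hcol]
      · rw [Equiv.swap_apply_of_ne_of_ne h1 h2]
  · intro j hj
    have hj := (mem_filter.1 hj).1
    by_cases h2 : j = b
    · subst h2
      rw [Equiv.swap_apply_right]
      have := chi_swap w s (col a) j
      rw [hs] at this
      rw [this, sg_neg]
    by_cases h3 : ∃ i, s i = j
    · obtain ⟨k, rfl⟩ := h3
      rw [chi_cons_self, sg_zero, neg_zero]
      have : Equiv.swap a b (s k) = Function.update s (col a) b k := by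
        by_cases hk : k = col a
        · subst hk; rw [hs]; simp
        · rw [Function.update_of_ne hk]
          apply Equiv.swap_apply_of_ne_of_ne _ (hsb k)
          intro h; apply hk; rw [← h, (hT k).2]
      rw [this, chi_cons_self, sg_zero]
    · push Not at h3
      have h1 : j ≠ a := by rintro rfl; exact h3 _ hs
      have := hneg (Fin.cons j s) (cons_inj hT.inj h3) (cons_mem (fun i => (hT i).1) hj)
        ⟨(col a).succ, by simp [hs]⟩ (by
          intro k
          refine Fin.cases ?_ (fun i => ?_) k
          · simpa using h2
          · simpa using hsb i)
      rw [this, neg_neg]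
      congr 2
      ext k
      refine Fin.cases ?_ (fun k => ?_) k
      · simp
      · simp only [Function.comp, Fin.cons_succ]
        by_cases hk : k = col a
        · subst hk; rw [hs]; simp
        · rw [Function.update_of_ne hk]
          apply Equiv.swap_apply_of_ne_of_ne _ (hsb k)
          intro h; apply hk; rw [← h, (hT k).2]

open Classical in
theorem cancel (S : Finset ι) (col : ι → Fin d) (w : ι → Fin (d+1) → ℝ) (a b : ι)
    (ha : a ∈ S) (hb : b ∈ S) (hab : a ≠ b) (hcol : col a = col b)
    (hneg : ∀ e : Fin (d+1) → ι, Function.Injective e → (∀ k, e k ∈ S) → (∃ k, e k = a) →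
      (∀ k, e k ≠ b) → sg (chi w e) = - sg (chi w (Equiv.swap a b ∘ e))) :
    (N S col w : ZMod 2) = (N ((S.erase a).erase b) col w : ZMod 2) := by
  unfold N
  set c := col a with hc
  refine parity_invol _ _ (fun s => if s c = a then Function.update s c b else
    if s c = b then Function.update s c a else s) ?_
  intro s hs
  have hQ : ∀ r : Fin d → ι, (r c = a ∨ r c = b) → ¬ Good ((S.erase a).erase b) col w r := by
    rintro r hr ⟨hT, _⟩
    have := (hT c).1
    simp only [mem_erase] at this
    tauto
  by_cases h1 : s c = a
  · have hP : Good S col w s := by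
      by_contra h; exact hs ⟨fun h' => absurd h' h, fun h' => absurd h' (hQ s (Or.inl h1))⟩
    have hP' : Good S col w (Function.update s c b) := by
      refine ⟨?_, fun i => ?_⟩
      · rw [hcol]; exact hP.1.update hb
      · rw [cancel_bal S col w a b ha hb hab hcol hneg s hP.1 h1 i, hP.2 i, neg_zero]
    simp only [h1, if_true]
    refine ⟨?_, ?_, ?_⟩
    · intro h; exact hQ _ (Or.inr (by simp)) (h.1 hP')
    · intro h; have := congrFun h c; simp [h1] at this; exact hab this.symm
    · simp only [Function.update_self, if_neg hab.symm, if_true, Function.update_idem]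
      rw [← h1]; simp
  · by_cases h2 : s c = b
    · have hP : Good S col w s := by
        by_contra h; exact hs ⟨fun h' => absurd h' h, fun h' => absurd h' (hQ s (Or.inr h2))⟩
      have hT' : Tr S col (Function.update s c a) := hP.1.update ha
      have hP' : Good S col w (Function.update s c a) := by
        refine ⟨hT', fun i => ?_⟩
        have := cancel_bal S col w a b ha hb hab hcol hneg _ hT' (by simp [← hc]) i
        rw [← hc, Function.update_idem, ← h2, Function.update_eq_self, hP.2 i] at this
        omega
      simp only [h2, if_neg hab.symm, if_true]
      refine ⟨?_, ?_, ?_⟩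
      · intro h; exact hQ _ (Or.inl (by simp)) (h.1 hP')
      · intro h; have := congrFun h c; simp [h2] at this; exact hab this
      · simp only [Function.update_self, if_true, Function.update_idem]
        rw [← h2]; simp
    · exfalso
      apply hs
      have hmem : ∀ i, col (s i) = i → s i ≠ a ∧ s i ≠ b := by
        intro i hi
        constructor
        · intro h; rw [h] at hi; subst hi; exact h1 h
        · intro h; rw [h, ← hcol] at hi; subst hi; exact h2 h
      have hTT : Tr S col s ↔ Tr ((S.erase a).erase b) col s := by
        unfold Tr
        refine forall_congr' fun i => ?_
        simp only [mem_erase]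
        constructor
        · rintro ⟨h, h'⟩; exact ⟨⟨(hmem i h').2, (hmem i h').1, h⟩, h'⟩
        · rintro ⟨⟨_, _, h⟩, h'⟩; exact ⟨h, h'⟩
      unfold Good
      rw [← hTT]
      refine and_congr_right fun hT => forall_congr' fun i => ?_
      suffices bal S col w s i = bal ((S.erase a).erase b) col w s i by rw [this]
      unfold bal
      rw [Finset.filter_erase, Finset.filter_erase]
      by_cases hi : c = i
      · have hbm : b ∈ (filter (fun j => col j = i) S).erase a := by
          simp [hab.symm, hb, ← hcol, hi]
        have ham : a ∈ filter (fun j => col j = i) S := by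
          simp [ha, ← hc, hi]
        rw [← Finset.add_sum_erase _ _ ham, ← Finset.add_sum_erase _ _ hbm]
        have hna : ∀ i, s i ≠ a := fun i => (hmem i (hT i).2).1
        have hnb : ∀ i, s i ≠ b := fun i => (hmem i (hT i).2).2
        have := hneg (Fin.cons a s) (cons_inj hT.inj hna) (cons_mem (fun i => (hT i).1) ha)
          ⟨0, rfl⟩ (by
            intro k
            refine Fin.cases ?_ (fun i => ?_) k
            · simpa using hab
            · simpa using hnb i)
        have e : (Equiv.swap a b ∘ (Fin.cons a s : Fin (d+1) → ι)) = Fin.cons b s := by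
          ext k
          refine Fin.cases ?_ (fun k => ?_) k
          · simp
          · simp only [Function.comp, Fin.cons_succ]
            exact Equiv.swap_apply_of_ne_of_ne (hna k) (hnb k)
        rw [e] at this
        rw [this]; ring
      · rw [Finset.erase_eq_of_notMem (s := filter (fun j => col j = i) S)
          (by simp only [mem_filter, not_and]; intro _; exact hi),
          Finset.erase_eq_of_notMem
          (by simp only [mem_filter, not_and]; intro _; rw [← hcol]; exact hi)]

/-- base case -/
lemma base (S : Finset ι) (col : ι → Fin d) (w : ι → Fin (d+1) → ℝ)
    (h : ∀ i, (S.filter (fun j => col j = i)).card = 1) : N S col w = 1 := by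
  classical
  unfold N
  rw [Finset.card_eq_one]
  have h' := fun i => Finset.card_eq_one.1 (h i)
  choose s hs using h'
  have hT : Tr S col s := by
    intro i
    have : s i ∈ filter (fun j => col j = i) S := by rw [hs]; simp
    simpa using this
  refine ⟨s, ?_⟩
  ext r
  simp only [mem_filter, mem_univ, true_and, mem_singleton]
  constructor
  · rintro ⟨hr, _⟩
    ext i
    have : r i ∈ filter (fun j => col j = i) S := by simpa using hr i
    rw [hs] at this
    simpa using this
  · rintro rfl
    refine ⟨hT, fun i => ?_⟩
    unfold bal
    rw [hs, Finset.sum_singleton, chi_cons_self, sg_zero]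

end
end HS
namespace HS
open Finset Filter Topology
set_option linter.unusedSectionVars false
set_option linter.unusedVariables false
section
variable {d : ℕ} {ι : Type*} [Fintype ι] [DecidableEq ι]

def Gen (S : Finset ι) (v : ι → Fin (d+1) → ℝ) : Prop :=
  ∀ e : Fin (d+1) → ι, Function.Injective e → (∀ k, e k ∈ S) → chi v e ≠ 0

/-- dependence on one row -/
noncomputable def lin (v : ι → Fin (d+1) → ℝ) (e : Fin (d+1) → ι) (k : Fin (d+1)) :
    (Fin (d+1) → ℝ) →ₗ[ℝ] ℝ :=
  (Matrix.detRowAlternating (n := Fin (d+1)) (R := ℝ)).toMultilinearMap.toLinearMap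
    (fun l => v (e l)) k

lemma lin_apply (v : ι → Fin (d+1) → ℝ) (e : Fin (d+1) → ι) (k : Fin (d+1)) (j : ι) :
    lin v e k (v j) = chi v (Function.update e k j) := by
  unfold lin chi
  simp only [MultilinearMap.toLinearMap_apply]
  show Matrix.det _ = _
  congr 1
  ext l m
  by_cases h : l = k
  · subst h; simp
  · simp [h]

lemma chi_update (v : ι → Fin (d+1) → ℝ) (e : Fin (d+1) → ι) (he : Function.Injective e)
    (k : Fin (d+1)) (a : ι) (hk : e k = a) (y : Fin (d+1) → ℝ) :
    chi (Function.update v a y) e = lin v e k y := by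
  unfold lin chi
  simp only [MultilinearMap.toLinearMap_apply]
  show _ = Matrix.det _
  congr 1
  ext l m
  by_cases h : l = k
  · subst h; simp [hk]
  · have : e l ≠ a := by rw [← hk]; exact fun h' => h (he h')
    simp [h, this]

lemma chi_update_of_not (v : ι → Fin (d+1) → ℝ) (e : Fin (d+1) → ι) (a : ι)
    (h : ∀ k, e k ≠ a) (y : Fin (d+1) → ℝ) :
    chi (Function.update v a y) e = chi v e :=
  chi_congr fun k => by simp [h k]

lemma lin_self (v : ι → Fin (d+1) → ℝ) (e : Fin (d+1) → ι) 
    (k : Fin (d+1)) : lin v e k (v (e k)) = chi v e := by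
  rw [lin_apply]; simp

lemma upd_inj {e : Fin (d+1) → ι} (he : Function.Injective e) (k : Fin (d+1)) (j : ι)
    (hj : ∀ l, l ≠ k → e l ≠ j) : Function.Injective (Function.update e k j) := by
  intro l m h
  by_cases hl : l = k <;> by_cases hm : m = k
  · rw [hl, hm]
  · subst hl; simp [hm] at h; exact absurd h.symm (hj m hm)
  · subst hm; simp [hl] at h; exact absurd h (hj l hl)
  · simp [hl, hm] at h; exact he h

lemma upd_mem {S : Finset ι} {e : Fin (d+1) → ι} (he : ∀ k, e k ∈ S) (k : Fin (d+1)) {j : ι}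
    (hj : j ∈ S) : ∀ l, Function.update e k j l ∈ S := by
  intro l
  by_cases hl : l = k
  · subst hl; simpa
  · simpa [hl] using he l

/-- pair genericity -/
def PG (S : Finset ι) (v : ι → Fin (d+1) → ℝ) (a b : ι) : Prop :=
  ∀ e e' : Fin (d+1) → ι, ∀ k k', Function.Injective e → Function.Injective e' →
    (∀ l, e l ∈ S) → (∀ l, e' l ∈ S) → e k = a → e' k' = a → (∀ l, e l ≠ b) → (∀ l, e' l ≠ b) →
    univ.image e ≠ univ.image e' →
    chi v e * chi v (Function.update e' k' b) ≠ chi v e' * chi v (Function.update e k b)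

/-- the path -/
noncomputable def pth (v : ι → Fin (d+1) → ℝ) (a b : ι) (t : ℝ) : ι → Fin (d+1) → ℝ :=
  Function.update v a (v a - t • v b)

lemma chi_pth (v : ι → Fin (d+1) → ℝ) (a b : ι) (t : ℝ) (e : Fin (d+1) → ι)
    (he : Function.Injective e) (k : Fin (d+1)) (hk : e k = a) :
    chi (pth v a b t) e = chi v e - t * chi v (Function.update e k b) := by
  unfold pth
  subst hk
  rw [chi_update v e he k _ rfl, map_sub, map_smul, lin_self, lin_apply, smul_eq_mul]

lemma chi_pth_affine (v : ι → Fin (d+1) → ℝ) (a b : ι) (e : Fin (d+1) → ι)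
    (he : Function.Injective e) : ∃ B : ℝ, ∀ t, chi (pth v a b t) e = chi v e - t * B := by
  by_cases h : ∃ k, e k = a
  · obtain ⟨k, hk⟩ := h
    exact ⟨_, fun t => chi_pth v a b t e he k hk⟩
  · push Not at h
    exact ⟨0, fun t => by rw [pth, chi_update_of_not v e a h]; simp⟩

lemma sg_eventually {f : ℝ → ℝ} (hf : Continuous f) {t0 : ℝ} (h : f t0 ≠ 0) :
    ∀ᶠ t in 𝓝 t0, sg (f t) = sg (f t0) := by
  rcases lt_or_gt_of_ne h with h | h
  · filter_upwards [hf.continuousAt.eventually_lt_const h] with t ht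
    rw [sg_of_neg h, sg_of_neg ht]
  · filter_upwards [hf.continuousAt.eventually_const_lt h] with t ht
    rw [sg_pos h, sg_pos ht]

lemma chi_pth_cont (v : ι → Fin (d+1) → ℝ) (a b : ι) (e : Fin (d+1) → ι)
    (he : Function.Injective e) : Continuous fun t => chi (pth v a b t) e := by
  obtain ⟨B, hB⟩ := chi_pth_affine v a b e he
  simp only [hB]
  fun_prop

lemma pth_degenerate {S : Finset ι} {v : ι → Fin (d+1) → ℝ} (hv : Gen S v) {a b : ι} (hab : a ≠ b) {t : ℝ}
    {e : Fin (d+1) → ι} (he : Function.Injective e) (heS : ∀ k, e k ∈ S)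
    (h0 : chi (pth v a b t) e = 0) :
    ∃ k, e k = a ∧ (∀ l, e l ≠ b) ∧ chi v e = t * chi v (Function.update e k b) := by
  have hA : ∃ k, e k = a := by
    by_contra h
    push Not at h
    rw [pth, chi_update_of_not v e a h] at h0
    exact hv e he heS h0
  obtain ⟨k, hk⟩ := hA
  rw [chi_pth v a b t e he k hk] at h0
  refine ⟨k, hk, ?_, by linarith⟩
  intro l hl
  by_cases hlk : l = k
  · exact hab (by rw [← hk, ← hl, hlk])
  · have : chi v (Function.update e k b) = 0 := by
      apply chi_eq_zero_of_not_inj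
      intro hi
      have := @hi l k (by simp [hlk, hl])
      exact hlk this
    rw [this] at h0
    exact hv e he heS (by linarith)
end
end HS
namespace HS
open Finset Filter Topology
set_option linter.unusedSectionVars false
set_option linter.unusedVariables false
section
variable {d : ℕ} {ι : Type*} [Fintype ι] [DecidableEq ι]

lemma wall_exists {S : Finset ι} {v : ι → Fin (d+1) → ℝ} (hv : Gen S v) {a b : ι} (hab : a ≠ b)
    (hpg : PG S v a b) (t0 : ℝ) :
    ∃ W : Finset ι, ∀ᶠ t in 𝓝[≠] t0, Wall S (pth v a b t0) (pth v a b t) W := by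
  obtain ⟨W, hW1, hW2⟩ : ∃ W : Finset ι,
      (∀ e : Fin (d+1) → ι, Function.Injective e → (∀ k, e k ∈ S) → univ.image e ≠ W →
        chi (pth v a b t0) e ≠ 0) ∧
      (∀ e : Fin (d+1) → ι, Function.Injective e → (∀ k, e k ∈ S) → univ.image e = W →
        chi (pth v a b t0) e = 0) := by
    by_cases hex : ∃ e : Fin (d+1) → ι, Function.Injective e ∧ (∀ k, e k ∈ S) ∧
        chi (pth v a b t0) e = 0
    · obtain ⟨e0, he0, heS0, h0⟩ := hex
      refine ⟨univ.image e0, ?_, ?_⟩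
      · intro e he heS hne h1
        obtain ⟨k, hk, hb, hA⟩ := pth_degenerate hv hab he heS h1
        obtain ⟨k0, hk0, hb0, hA0⟩ := pth_degenerate hv hab he0 heS0 h0
        refine hpg e e0 k k0 he he0 heS heS0 hk hk0 hb hb0 hne ?_
        rw [hA, hA0]; ring
      · intro e he heS heq
        exact chi_image _ he0 heq.symm he h0
    · push Not at hex
      refine ⟨∅, fun e he heS _ => hex e he heS, ?_⟩
      intro e he heS h
      exfalso
      have : e 0 ∈ univ.image e := by simp
      rw [h] at this; simp at this
  refine ⟨W, ?_⟩
  have hall : ∀ᶠ t in 𝓝[≠] t0, ∀ e : Fin (d+1) → ι, Function.Injective e → (∀ k, e k ∈ S) →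
      univ.image e ≠ W → sg (chi (pth v a b t) e) = sg (chi (pth v a b t0) e) := by
    apply Filter.Eventually.filter_mono nhdsWithin_le_nhds
    rw [eventually_all]
    intro e
    by_cases he : Function.Injective e ∧ (∀ k, e k ∈ S) ∧ univ.image e ≠ W
    · filter_upwards [sg_eventually (chi_pth_cont v a b e he.1) (hW1 e he.1 he.2.1 he.2.2)] with t ht
      intros; exact ht
    · exact Eventually.of_forall fun t h1 h2 h3 => absurd ⟨h1, h2, h3⟩ he
  filter_upwards [hall, self_mem_nhdsWithin] with t ht htne
  refine ⟨fun e he heS hne => ⟨hW1 e he heS hne, ht e he heS hne⟩, fun e he heS heq =>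
    ⟨hW2 e he heS heq, ?_⟩⟩
  have h0 := hW2 e he heS heq
  obtain ⟨B, hB⟩ := chi_pth_affine v a b e he
  rw [hB] at h0 ⊢
  intro h1
  have : (t - t0) * B = 0 := by linarith
  rcases mul_eq_zero.1 this with h | h
  · exact htne (by simp; linarith)
  · rw [h] at h0; exact hv e he heS (by linarith)

lemma move {S : Finset ι} {v : ι → Fin (d+1) → ℝ} (col : ι → Fin d) (hv : Gen S v) {a b : ι}
    (hab : a ≠ b) (hpg : PG S v a b) (t t' : ℝ) (ht : Gen S (pth v a b t))
    (ht' : Gen S (pth v a b t')) :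
    (N S col (pth v a b t) : ZMod 2) = (N S col (pth v a b t') : ZMod 2) := by
  have hg : ∀ t0 : ℝ, ∃ g : ZMod 2, ∀ᶠ t in 𝓝[≠] t0, (N S col (pth v a b t) : ZMod 2) = g := by
    intro t0
    obtain ⟨W, hW⟩ := wall_exists hv hab hpg t0
    obtain ⟨t1, ht1⟩ := hW.exists
    refine ⟨(N S col (pth v a b t1) : ZMod 2), ?_⟩
    filter_upwards [hW] with t ht
    exact cross S col _ _ _ W ht ht1
  choose g hg using hg
  have hloc : IsLocallyConstant g := by
    rw [IsLocallyConstant.iff_eventually_eq]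
    intro t0
    have := eventually_nhds_nhdsWithin.2 (hg t0)
    filter_upwards [this] with y hy
    by_cases hyt : y = t0
    · rw [hyt]
    · have h1 : ∀ᶠ x in 𝓝[≠] y, (N S col (pth v a b x) : ZMod 2) = g t0 := by
        have : 𝓝[{t0}ᶜ] y = 𝓝 y := IsOpen.nhdsWithin_eq isOpen_compl_singleton hyt
        rw [this] at hy
        exact hy.filter_mono nhdsWithin_le_nhds
      obtain ⟨x, hx1, hx2⟩ := (h1.and (hg y)).exists
      rw [← hx1, ← hx2]
  have hval : ∀ t, Gen S (pth v a b t) → (N S col (pth v a b t) : ZMod 2) = g t := by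
    intro t ht
    have : ∀ᶠ x in 𝓝[≠] t, N S col (pth v a b x) = N S col (pth v a b t) := by
      apply Filter.Eventually.filter_mono nhdsWithin_le_nhds
      have : ∀ᶠ x in 𝓝 t, ∀ e : Fin (d+1) → ι, Function.Injective e → (∀ k, e k ∈ S) →
          sg (chi (pth v a b x) e) = sg (chi (pth v a b t) e) := by
        rw [eventually_all]
        intro e
        by_cases he : Function.Injective e ∧ (∀ k, e k ∈ S)
        · filter_upwards [sg_eventually (chi_pth_cont v a b e he.1) (ht e he.1 he.2)] with x hx
          intros; exact hx
        · exact Eventually.of_forall fun t h1 h2 => absurd ⟨h1, h2⟩ he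
      filter_upwards [this] with x hx
      exact N_congr S col _ _ hx
    obtain ⟨x, hx1, hx2⟩ := (this.and (hg t)).exists
    rw [← hx1, hx2]
  rw [hval t ht, hval t' ht']
  exact hloc.apply_eq_of_preconnectedSpace t t'

lemma N_congr_val (S : Finset ι) (col : ι → Fin d) (v v' : ι → Fin (d+1) → ℝ)
    (h : ∀ j ∈ S, v j = v' j) : N S col v = N S col v' :=
  N_congr S col v v' fun e _ heS => by rw [chi_congr fun k => h _ (heS k)]

lemma swap_comp {e : Fin (d+1) → ι} (he : Function.Injective e) {a b : ι} {k : Fin (d+1)}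
    (hk : e k = a) (hb : ∀ l, e l ≠ b) : Equiv.swap a b ∘ e = Function.update e k b := by
  ext l
  by_cases hl : l = k
  · subst hl; simp [hk]
  · simp only [Function.comp, Function.update_of_ne hl]
    exact Equiv.swap_apply_of_ne_of_ne (fun h => hl (he (h.trans hk.symm))) (hb l)

lemma reduce_pg {S : Finset ι} {v : ι → Fin (d+1) → ℝ} (col : ι → Fin d) (hv : Gen S v) {a b : ι}
    (ha : a ∈ S) (hb : b ∈ S) (hcol : col a = col b)
    (hab : a ≠ b) (hpg : PG S v a b) :
    (N S col v : ZMod 2) = (N ((S.erase a).erase b) col v : ZMod 2) := by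
  have h1 : ∀ᶠ t : ℝ in atTop, Gen S (pth v a b t) := by
    have : ∀ᶠ t : ℝ in atTop, ∀ e : Fin (d+1) → ι, Function.Injective e → (∀ k, e k ∈ S) →
        chi (pth v a b t) e ≠ 0 := by
      rw [eventually_all]
      intro e
      by_cases he : Function.Injective e ∧ (∀ k, e k ∈ S)
      · obtain ⟨B, hB⟩ := chi_pth_affine v a b e he.1
        filter_upwards [eventually_ne_atTop (chi v e / B)] with t ht _ _
        rw [hB]
        intro h0
        by_cases hB0 : B = 0
        · rw [hB0] at h0; exact hv e he.1 he.2 (by linarith)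
        · apply ht; field_simp; linarith
      · exact Eventually.of_forall fun t h1 h2 => absurd ⟨h1, h2⟩ he
    exact this
  have h2 : ∀ᶠ t : ℝ in atTop, ∀ e : Fin (d+1) → ι, Function.Injective e → (∀ k, e k ∈ S) →
      (∃ k, e k = a) → (∀ k, e k ≠ b) →
      sg (chi (pth v a b t) e) = - sg (chi (pth v a b t) (Equiv.swap a b ∘ e)) := by
    rw [eventually_all]
    intro e
    by_cases he : Function.Injective e ∧ (∀ k, e k ∈ S) ∧ (∃ k, e k = a) ∧ (∀ k, e k ≠ b)
    · obtain ⟨hi, hS, ⟨k, hk⟩, hnb⟩ := he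
      have hB : chi v (Function.update e k b) ≠ 0 :=
        hv _ (upd_inj hi k b fun l _ => hnb l) (upd_mem hS k hb)
      have hsw : ∀ t, chi (pth v a b t) (Equiv.swap a b ∘ e) = chi v (Function.update e k b) := by
        intro t
        rw [swap_comp hi hk hnb, pth, chi_update_of_not]
        intro l
        by_cases hl : l = k
        · subst hl; simpa using hab.symm
        · simp only [Function.update_of_ne hl]
          exact fun h => hl (hi (h.trans hk.symm))
      filter_upwards [eventually_gt_atTop (chi v e / chi v (Function.update e k b))] with t ht _ _ _ _
      rw [hsw, chi_pth v a b t e hi k hk]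
      rcases lt_or_gt_of_ne hB with h | h
      · rw [sg_of_neg h, sg_pos, neg_neg]
        rw [div_lt_iff_of_neg h] at ht
        linarith
      · rw [sg_pos h, sg_of_neg]
        rw [div_lt_iff₀ h] at ht
        linarith
    · exact Eventually.of_forall fun t h1 h2 h3 h4 => absurd ⟨h1, h2, h3, h4⟩ he
  obtain ⟨t, ht1, ht2⟩ := (h1.and h2).exists
  have h0 : pth v a b 0 = v := by simp [pth]
  have e1 := move col hv hab hpg 0 t (by rw [h0]; exact hv) ht1
  rw [h0] at e1
  rw [e1, cancel S col _ a b ha hb hab hcol ht2]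
  congr 1
  apply N_congr_val
  intro j hj
  simp only [mem_erase] at hj
  simp [pth, hj.2.1]

lemma dense_ne (L : (Fin (d+1) → ℝ) →ₗ[ℝ] ℝ) (hL : L ≠ 0) :
    IsOpen {p | L p ≠ 0} ∧ Dense {p | L p ≠ 0} := by
  have hc : Continuous L := L.continuous_of_finiteDimensional
  refine ⟨isOpen_ne_fun hc continuous_const, ?_⟩
  exact (dense_compl_singleton (0:ℝ)).preimage
    (LinearMap.isOpenMap_of_finiteDimensional L (LinearMap.surjective hL))

lemma perturb {S : Finset ι} {v : ι → Fin (d+1) → ℝ} (hv : Gen S v) {a b : ι}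
    (ha : a ∈ S) (hb : b ∈ S) (hab : a ≠ b) :
    ∃ p, (∀ e : Fin (d+1) → ι, Function.Injective e → (∀ k, e k ∈ S) →
      sg (chi (Function.update v a p) e) = sg (chi v e)) ∧ PG S (Function.update v a p) a b := by
  classical
  let T := (Fin (d+1) → ι) × (Fin (d+1) → ι) × Fin (d+1) × Fin (d+1)
  let C : T → Prop := fun τ =>
    Function.Injective τ.1 ∧ Function.Injective τ.2.1 ∧
    (∀ l, τ.1 l ∈ S) ∧ (∀ l, τ.2.1 l ∈ S) ∧ τ.1 τ.2.2.1 = a ∧ τ.2.1 τ.2.2.2 = a ∧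
    (∀ l, τ.1 l ≠ b) ∧ (∀ l, τ.2.1 l ≠ b) ∧ univ.image τ.1 ≠ univ.image τ.2.1
  let L : T → ((Fin (d+1) → ℝ) →ₗ[ℝ] ℝ) := fun τ =>
    (chi v (Function.update τ.2.1 τ.2.2.2 b)) • lin v τ.1 τ.2.2.1
    - (chi v (Function.update τ.1 τ.2.2.1 b)) • lin v τ.2.1 τ.2.2.2
  have hL : ∀ τ, C τ → L τ ≠ 0 := by
    rintro ⟨e, e', k, k'⟩ ⟨hi, hi', hS, hS', hk, hk', hnb, hnb', hne⟩
    simp only at hi hi' hS hS' hk hk' hnb hnb' hne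
    have : ∃ l, e' l ∉ univ.image e := by
      by_contra h
      push Not at h
      apply hne
      symm
      apply Finset.eq_of_subset_of_card_le
      · intro x hx
        obtain ⟨l, _, rfl⟩ := mem_image.1 hx
        exact h l
      · rw [Finset.card_image_of_injective _ hi, Finset.card_image_of_injective _ hi']
    obtain ⟨l, hl⟩ := this
    have hl' : ∀ m, e m ≠ e' l := by
      intro m h; apply hl; rw [← h]; simp
    have hlk : l ≠ k' := by
      rintro rfl; exact hl' k (hk.trans hk'.symm)
    intro h0
    have h1 := congrArg (fun F => F (v (e' l))) h0
    simp only [L, LinearMap.sub_apply, LinearMap.smul_apply, lin_apply, LinearMap.zero_apply,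
      smul_eq_mul] at h1
    have z : chi v (Function.update e' k' (e' l)) = 0 := by
      apply chi_eq_zero_of_not_inj
      intro hh
      exact hlk (@hh l k' (by simp [hlk]))
    rw [z, mul_zero, sub_zero] at h1
    rcases mul_eq_zero.1 h1 with h | h
    · exact hv _ (upd_inj hi' k' b fun l _ => hnb' l) (upd_mem hS' k' hb) h
    · exact hv _ (upd_inj hi k _ fun m _ => hl' m) (upd_mem hS k (hS' l)) h
  have hD : Dense (⋂ τ : {τ // C τ}, {p | L τ.1 p ≠ 0}) :=
    dense_iInter_of_isOpen (fun τ => (dense_ne _ (hL τ.1 τ.2)).1)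
      (fun τ => (dense_ne _ (hL τ.1 τ.2)).2)
  have hU : ∀ᶠ p in 𝓝 (v a), ∀ e : Fin (d+1) → ι, Function.Injective e → (∀ k, e k ∈ S) →
      sg (chi (Function.update v a p) e) = sg (chi v e) := by
    rw [eventually_all]
    intro e
    by_cases he : Function.Injective e ∧ (∀ k, e k ∈ S)
    · by_cases hk : ∃ k, e k = a
      · obtain ⟨k, hk⟩ := hk
        have hc : ContinuousAt (lin v e k) (v a) :=
          (lin v e k).continuous_of_finiteDimensional.continuousAt
        have hva : lin v e k (v a) = chi v e := by rw [← hk, lin_self]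
        rcases lt_or_gt_of_ne (hv e he.1 he.2) with h | h
        · filter_upwards [hc.eventually_lt_const (hva.trans_lt h)] with p hp _ _
          rw [chi_update v e he.1 k a hk, sg_of_neg h, sg_of_neg hp]
        · filter_upwards [hc.eventually_const_lt (h.trans_eq hva.symm)] with p hp _ _
          rw [chi_update v e he.1 k a hk, sg_pos h, sg_pos hp]
      · push Not at hk
        exact Eventually.of_forall fun p _ _ => by rw [chi_update_of_not v e a hk]
    · exact Eventually.of_forall fun t h1 h2 => absurd ⟨h1, h2⟩ he
  obtain ⟨U, hUs, hUo, hUm⟩ := mem_nhds_iff.1 hU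
  obtain ⟨p, hpU, hpD⟩ := hD.inter_open_nonempty U hUo ⟨_, hUm⟩
  refine ⟨p, hUs hpU, ?_⟩
  intro e e' k k' hi hi' hS hS' hk hk' hnb hnb' hne
  have hp := Set.mem_iInter.1 hpD ⟨(e, e', k, k'), hi, hi', hS, hS', hk, hk', hnb, hnb', hne⟩
  simp only [L, Set.mem_ofPred_eq, LinearMap.sub_apply, LinearMap.smul_apply, smul_eq_mul] at hp
  have aux : ∀ (e : Fin (d+1) → ι) k, Function.Injective e → e k = a →
      ∀ l, Function.update e k b l ≠ a := by
    intro e k hi hk l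
    by_cases hl : l = k
    · subst hl; simpa using hab.symm
    · simp only [Function.update_of_ne hl]
      exact fun h => hl (hi (h.trans hk.symm))
  rw [chi_update_of_not v _ a (aux e k hi hk), chi_update_of_not v _ a (aux e' k' hi' hk'),
    chi_update v e hi k a hk, chi_update v e' hi' k' a hk']
  intro h
  apply hp
  linarith

lemma reduce {S : Finset ι} {v : ι → Fin (d+1) → ℝ} (col : ι → Fin d) (hv : Gen S v) {a b : ι}
    (ha : a ∈ S) (hb : b ∈ S) (hcol : col a = col b) (hab : a ≠ b) :
    (N S col v : ZMod 2) = (N ((S.erase a).erase b) col v : ZMod 2) := by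
  obtain ⟨p, hp, hpg⟩ := perturb hv ha hb hab
  have hg : Gen S (Function.update v a p) := by
    intro e he heS h0
    have := hp e he heS
    rw [h0, sg_zero] at this
    exact hv e he heS (sg_eq_zero.1 this.symm)
  rw [← N_congr S col _ _ hp, reduce_pg col hg ha hb hcol hab hpg]
  congr 1
  apply N_congr_val
  intro j hj
  simp only [mem_erase] at hj
  simp [hj.2.1]

theorem odd_count (m : ℕ) : ∀ (S : Finset ι) (v : ι → Fin (d+1) → ℝ) (col : ι → Fin d),
    S.card = m → Gen S v → (∀ i, Odd (S.filter (fun j => col j = i)).card) →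
    (N S col v : ZMod 2) = 1 := by
  induction m using Nat.strong_induction_on with
  | _ m ih =>
  intro S v col hm hv hodd
  by_cases h1 : ∀ i, (S.filter (fun j => col j = i)).card = 1
  · rw [base S col v h1]; simp
  · push Not at h1
    obtain ⟨i, hi⟩ := h1
    have h2 : 1 < (S.filter (fun j => col j = i)).card := by
      have := (hodd i).pos; omega
    obtain ⟨a, ha, b, hb, hab⟩ := Finset.one_lt_card.1 h2
    rw [mem_filter] at ha hb
    rw [reduce col hv ha.1 hb.1 (ha.2.trans hb.2.symm) hab]
    have hbm : b ∈ S.erase a := by simp [hab.symm, hb.1]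
    refine ih _ ?_ _ v col rfl ?_ ?_
    · rw [Finset.card_erase_of_mem hbm, Finset.card_erase_of_mem ha.1]
      have : 0 < S.card := Finset.card_pos.2 ⟨a, ha.1⟩
      omega
    · intro e he heS
      exact hv e he fun k => mem_of_mem_erase (mem_of_mem_erase (heS k))
    · intro i'
      rw [Finset.filter_erase, Finset.filter_erase]
      by_cases hi' : i = i'
      · subst hi'
        have hbm' : b ∈ (filter (fun j => col j = i) S).erase a := by
          simp [hab.symm, hb.1, hb.2]
        have ham : a ∈ filter (fun j => col j = i) S := by simp [ha.1, ha.2]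
        rw [Finset.card_erase_of_mem hbm', Finset.card_erase_of_mem ham]
        have := hodd i
        rw [Nat.odd_iff] at this ⊢
        omega
      · rw [Finset.erase_eq_of_notMem (s := filter (fun j => col j = i') S)
          (by simp only [mem_filter, not_and]; intro _; rw [ha.2]; exact hi'),
          Finset.erase_eq_of_notMem
          (by simp only [mem_filter, not_and]; intro _; rw [hb.2]; exact hi')]
        exact hodd i'

theorem exists_good (S : Finset ι) (v : ι → Fin (d+1) → ℝ) (col : ι → Fin d)
    (hv : Gen S v) (hodd : ∀ i, Odd (S.filter (fun j => col j = i)).card) :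
    ∃ s, Good S col v s := by
  have h := odd_count S.card S v col rfl hv hodd
  by_contra hne
  push Not at hne
  have : N S col v = 0 := by
    classical
    unfold N
    rw [Finset.card_eq_zero, Finset.filter_eq_empty_iff]
    intro s _; exact hne s
  rw [this] at h
  simp at h

end
end HS
namespace HS
open Finset Filter Topology
set_option linter.unusedSectionVars false
set_option linter.unusedVariables false
section

lemma exists_between {α : Type*} [DecidableEq α] (A : Finset α) (lo hi : α → ℕ)
    (h : ∀ i, lo i ≤ hi i) :
    ∀ T, ∑ i ∈ A, lo i ≤ T → T ≤ ∑ i ∈ A, hi i →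
    ∃ a : α → ℕ, (∀ i, lo i ≤ a i ∧ a i ≤ hi i) ∧ ∑ i ∈ A, a i = T := by
  induction A using Finset.induction_on with
  | empty =>
    intro T h1 h2
    exact ⟨lo, fun i => ⟨le_rfl, h i⟩, by simp at h2 ⊢; omega⟩
  | insert x A hx ih =>
    intro T h1 h2
    rw [Finset.sum_insert hx] at h1 h2
    have hs : ∑ i ∈ A, lo i ≤ ∑ i ∈ A, hi i := Finset.sum_le_sum fun i _ => h i
    have hxx := h x
    obtain ⟨y, hy1, hy2, hy3, hy4, hy5⟩ : ∃ y, lo x ≤ y ∧ y ≤ hi x ∧ y ≤ T ∧ ∑ i ∈ A, lo i ≤ T - y ∧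
        T - y ≤ ∑ i ∈ A, hi i := by
      by_cases hc : T ≤ lo x + ∑ i ∈ A, hi i
      · exact ⟨lo x, by omega, by omega, by omega, by omega, by omega⟩
      · exact ⟨T - ∑ i ∈ A, hi i, by omega, by omega, by omega, by omega, by omega⟩
    obtain ⟨a, ha, hT⟩ := ih (T - y) hy4 hy5
    refine ⟨Function.update a x y, ?_, ?_⟩
    · intro i
      by_cases hi : i = x
      · subst hi; simp [hy1, hy2]
      · simpa [hi] using ha i
    · rw [Finset.sum_insert hx, Finset.sum_update_of_notMem hx, hT]
      simp; omega

lemma comb (d n : ℕ) (hn : 2 ≤ n) (m P : Fin d → ℕ) (hm : ∀ i, n ≤ m i)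
    (hsum : ∑ i, m i = (d+1) * n) (hP : ∀ i, 2 * P i ≤ m i ∧ m i ≤ 2 * P i + 2) :
    ∃ (k : ℕ) (a : Fin d → ℕ), 1 ≤ k ∧ k < n ∧
      (∀ i, P i ≤ a i ∧ a i ≤ P i + 1 ∧ k ≤ a i ∧ a i + n ≤ m i + k) ∧
      ∑ i, a i = (d+1) * k := by
  rcases Nat.even_or_odd' n with ⟨q, hq | hq⟩
  · have h1 : ∑ i, 2 * (m i / 2) ≤ ∑ i, m i := Finset.sum_le_sum fun i _ => by omega
    have h2 : ∑ i, m i ≤ ∑ i, 2 * ((m i + 1) / 2) := Finset.sum_le_sum fun i _ => by omega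
    rw [← Finset.mul_sum] at h1 h2
    have h3 : (d+1) * n = 2 * ((d+1) * q) := by rw [hq]; ring
    obtain ⟨a, ha, hT⟩ := exists_between univ (fun i => m i / 2) (fun i => (m i + 1) / 2)
      (fun i => by show m i / 2 ≤ (m i + 1) / 2; omega) ((d+1) * q) (by omega) (by omega)
    refine ⟨q, a, by omega, by omega, fun i => ?_, hT⟩
    have := ha i; have := hm i; have := hP i
    omega
  · have h3 : (d+1) * n = 2 * ((d+1) * q) + (d+1) := by rw [hq]; ring
    have h4 : (d+1) * (q+1) = (d+1) * q + (d+1) := by ring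
    by_cases hD : ∑ i, (2 * P i + 1) + 1 ≤ ∑ i, m i
    · have h2 : ∑ i, m i ≤ ∑ i, (2 * (m i / 2) + 1) := Finset.sum_le_sum fun i _ => by omega
      rw [Finset.sum_add_distrib, ← Finset.mul_sum] at hD h2
      simp only [sum_const, card_univ, Fintype.card_fin, smul_eq_mul, mul_one] at hD h2
      obtain ⟨a, ha, hT⟩ := exists_between univ P (fun i => m i / 2)
        (fun i => by have := hP i; show P i ≤ m i / 2; omega) ((d+1) * q) (by omega) (by omega)
      refine ⟨q, a, by omega, by omega, fun i => ?_, hT⟩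
      have := ha i; have := hm i; have := hP i
      omega
    · have h2 : ∑ i, 2 * ((m i + 1) / 2) ≤ ∑ i, (m i + 1) := Finset.sum_le_sum fun i _ => by omega
      rw [Finset.sum_add_distrib, ← Finset.mul_sum] at hD h2
      simp only [sum_const, card_univ, Fintype.card_fin, smul_eq_mul, mul_one] at hD h2
      have h5 : ∑ i, (P i + 1) = ∑ i, P i + d := by
        rw [Finset.sum_add_distrib]; simp
      obtain ⟨a, ha, hT⟩ := exists_between univ (fun i => (m i + 1) / 2) (fun i => P i + 1)
        (fun i => by have := hP i; show (m i + 1) / 2 ≤ P i + 1; omega) ((d+1) * (q+1))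
        (by omega) (by omega)
      refine ⟨q + 1, a, by omega, by omega, fun i => ?_, hT⟩
      have := ha i; have := hm i; have := hP i
      omega

variable {d : ℕ} {ι : Type*} [Fintype ι] [DecidableEq ι]

lemma sum_sg (A : Finset ι) (f : ι → ℝ) :
    ∑ j ∈ A, sg (f j) = ((A.filter fun j => 0 < f j).card : ℤ) - ((A.filter fun j => f j < 0).card : ℤ) := by
  simp only [Finset.card_filter]
  push_cast
  rw [← Finset.sum_sub_distrib]
  refine Finset.sum_congr rfl fun j _ => ?_
  rcases lt_trichotomy (f j) 0 with h | h | h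
  · rw [sg_of_neg h, if_neg h.not_gt, if_pos h]; norm_num
  · rw [h, sg_zero]; simp
  · rw [sg_pos h, if_neg h.not_gt, if_pos h]; norm_num

theorem core (n : ℕ) (hn : 2 ≤ n) (v : ι → Fin (d+1) → ℝ) (col : ι → Fin d)
    (hv : Gen univ v) (m : Fin d → ℕ) (hmdef : ∀ i, (univ.filter (fun j => col j = i)).card = m i)
    (hm : ∀ i, n ≤ m i) (hsum : ∑ i, m i = (d+1) * n) :
    ∃ F : (Fin (d+1) → ℝ) →ₗ[ℝ] ℝ, (∀ j, F (v j) ≠ 0) ∧ ∃ (k : ℕ) (a : Fin d → ℕ), 1 ≤ k ∧ k < n ∧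
      (∀ i, (univ.filter (fun j => col j = i ∧ 0 < F (v j))).card = a i) ∧
      (∀ i, k ≤ a i ∧ a i + n ≤ m i + k) ∧ ∑ i, a i = (d+1) * k := by
  have hr : ∀ i, ∃ j, col j = i := by
    intro i
    have : 0 < (univ.filter (fun j => col j = i)).card := by rw [hmdef]; have := hm i; omega
    obtain ⟨j, hj⟩ := Finset.card_pos.1 this
    exact ⟨j, by simpa using hj⟩
  choose r hr using hr
  let S : Finset ι := univ.filter (fun j => ¬ (Even (m (col j)) ∧ j = r (col j)))
  have hSf : ∀ i, S.filter (fun j => col j = i) = if Even (m i) then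
      (univ.filter (fun j => col j = i)).erase (r i) else univ.filter (fun j => col j = i) := by
    intro i
    ext j
    split_ifs with he
    · simp only [S, mem_filter, mem_univ, true_and, mem_erase]
      constructor
      · rintro ⟨h1, rfl⟩; exact ⟨fun h => h1 ⟨he, h⟩, rfl⟩
      · rintro ⟨h1, rfl⟩; exact ⟨fun h => h1 h.2, rfl⟩
    · simp only [S, mem_filter, mem_univ, true_and]
      constructor
      · rintro ⟨h1, rfl⟩; rfl
      · rintro rfl; exact ⟨fun h => he h.1, rfl⟩
  have hrm : ∀ i, r i ∈ univ.filter (fun j => col j = i) := by intro i; simp [hr]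
  have hodd : ∀ i, Odd (S.filter (fun j => col j = i)).card := by
    intro i
    rw [hSf]
    split_ifs with he
    · rw [Finset.card_erase_of_mem (hrm i), hmdef]
      have := hm i
      rw [Nat.odd_iff]; rw [Nat.even_iff] at he; omega
    · rw [hmdef]; exact Nat.not_even_iff_odd.1 he
  obtain ⟨s, hT, hb⟩ := exists_good S v col (fun e he _ => hv e he fun _ => mem_univ _) hodd
  have hcs : ∀ i, col (s i) = i := fun i => (hT i).2
  set φ := fn v s with hφ
  have hz : ∀ i, φ (v (s i)) = 0 := by intro i; rw [hφ, fn_apply, chi_cons_self]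
  have hnz : ∀ j, j ≠ s (col j) → φ (v j) ≠ 0 := by
    intro j hj
    rw [hφ, fn_apply]
    refine hv _ (cons_inj hT.inj ?_) fun _ => mem_univ _
    rintro i rfl
    exact hj (by rw [hcs])
  let P : Fin d → ℕ := fun i => ((univ.filter (fun j => col j = i)).filter fun j => 0 < φ (v j)).card
  let M : Fin d → ℕ := fun i => ((univ.filter (fun j => col j = i)).filter fun j => φ (v j) < 0).card
  have hPM : ∀ i, P i + M i + 1 = m i := by
    intro i
    rw [← hmdef i]
    have e1 : univ.filter (fun j => col j = i) = insert (s i)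
        (((univ.filter (fun j => col j = i)).filter fun j => 0 < φ (v j)) ∪
        ((univ.filter (fun j => col j = i)).filter fun j => φ (v j) < 0)) := by
      ext j
      simp only [mem_filter, mem_univ, true_and, mem_insert, mem_union]
      constructor
      · rintro rfl
        by_cases h : j = s (col j)
        · exact Or.inl h
        · right
          rcases lt_or_gt_of_ne (hnz j h) with h | h
          · right; exact ⟨rfl, h⟩
          · left; exact ⟨rfl, h⟩
      · rintro (rfl | ⟨h, _⟩ | ⟨h, _⟩)
        · exact hcs i
        · exact h
        · exact h
    rw [e1, Finset.card_insert_of_notMem, Finset.card_union_of_disjoint]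
    · rw [Finset.disjoint_left]
      intro j h1 h2
      have h1 := (mem_filter.1 h1).2
      have h2 := (mem_filter.1 h2).2
      linarith
    · simp [hz]
  have hB : ∀ i, |(P i : ℤ) - M i| ≤ 1 := by
    intro i
    have e := sum_sg (univ.filter (fun j => col j = i)) (fun j => φ (v j))
    have hbi := hb i
    unfold bal at hbi
    simp only [← fn_apply, ← hφ] at hbi
    rw [hSf] at hbi
    show |(((univ.filter (fun j => col j = i)).filter fun j => 0 < φ (v j)).card : ℤ) - _| ≤ 1
    rw [← e]
    split_ifs at hbi with he
    · rw [← Finset.add_sum_erase _ _ (hrm i), hbi, add_zero]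
      by_cases h : φ (v (r i)) = 0
      · rw [h, sg_zero]; simp
      · rcases sg_cases h with h | h <;> rw [h] <;> simp
    · rw [hbi]; simp
  obtain ⟨k, a, hk1, hk2, ha, hsa⟩ := comb d n hn m P hm hsum (by
    intro i
    have h1 := hPM i
    have h2 := abs_le.1 (hB i)
    omega)
  -- a point off the hyperplane
  have hj0 : ∃ j0, ∀ i, s i ≠ j0 := by
    by_contra hcon
    push Not at hcon
    have h1 : Fintype.card ι ≤ d := by
      simpa using Fintype.card_le_of_surjective s hcon
    have h2 : ∑ i, m i = Fintype.card ι := by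
      rw [← Finset.card_univ, Finset.card_eq_sum_card_fiberwise (f := col) (t := univ) (by simp)]
      exact Finset.sum_congr rfl fun i _ => (hmdef i).symm
    nlinarith
  obtain ⟨j0, hj0⟩ := hj0
  have hc0 : chi v (Fin.cons j0 s : Fin (d+1) → ι) ≠ 0 :=
    hv _ (cons_inj hT.inj hj0) fun _ => mem_univ _
  let ε : Fin d → ℝ := fun i => if a i = P i then -1 else 1
  let g : (Fin (d+1) → ℝ) →ₗ[ℝ] ℝ := (bas v _ hc0).constr ℝ (Fin.cons 0 ε : Fin (d+1) → ℝ)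
  have hg : ∀ i, g (v (s i)) = ε i := by
    intro i
    have := (bas v _ hc0).constr_basis ℝ (Fin.cons 0 ε : Fin (d+1) → ℝ) i.succ
    rw [bas_apply, Fin.cons_succ, Fin.cons_succ] at this
    exact this
  have hev : ∀ᶠ t : ℝ in 𝓝 0, ∀ j, j ≠ s (col j) → sg (φ (v j) + t * g (v j)) = sg (φ (v j)) := by
    rw [eventually_all]
    intro j
    by_cases hj : j = s (col j)
    · exact Eventually.of_forall fun t h => absurd hj h
    · have := sg_eventually (f := fun t => φ (v j) + t * g (v j)) (by fun_prop) (t0 := 0)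
        (by simpa using hnz j hj)
      filter_upwards [this] with t ht _
      simpa using ht
  obtain ⟨t, ht, htpos⟩ := ((hev.filter_mono (nhdsWithin_le_nhds (s := Set.Ioi 0))).and
    (self_mem_nhdsWithin)).exists
  have htpos : 0 < t := htpos
  have hFs : ∀ i, (φ + t • g) (v (s i)) = t * ε i := by
    intro i; simp [hz, hg]
  have hFn : ∀ j, j ≠ s (col j) → sg ((φ + t • g) (v j)) = sg (φ (v j)) := by
    intro j hj; simpa using ht j hj
  have hpos : ∀ x y : ℝ, sg x = sg y → (0 < x ↔ 0 < y) := by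
    intro x y h
    rcases lt_trichotomy x 0 with h1 | h1 | h1 <;> rcases lt_trichotomy y 0 with h2 | h2 | h2
    all_goals first
      | (rw [sg_of_neg h1] at h) | (rw [h1, sg_zero] at h) | (rw [sg_pos h1] at h)
    all_goals first
      | (rw [sg_of_neg h2] at h) | (rw [h2, sg_zero] at h) | (rw [sg_pos h2] at h)
    all_goals first
      | (exfalso; omega)
      | (constructor <;> intro <;> linarith)
  refine ⟨φ + t • g, ?_, k, a, hk1, hk2, ?_, fun i => ⟨(ha i).2.2.1, (ha i).2.2.2⟩, hsa⟩
  · intro j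
    by_cases hj : j = s (col j)
    · rw [hj, hFs]
      apply mul_ne_zero htpos.ne'
      simp only [ε]; split_ifs <;> norm_num
    · intro h0
      have := hFn j hj
      rw [h0, sg_zero] at this
      exact hnz j hj (sg_eq_zero.1 this.symm)
  · intro i
    have hsn : s i ∉ (univ.filter (fun j => col j = i)).filter fun j => 0 < φ (v j) := by
      simp [hz]
    by_cases hai : a i = P i
    · rw [hai]
      show _ = ((univ.filter (fun j => col j = i)).filter fun j => 0 < φ (v j)).card
      congr 1
      ext j
      simp only [mem_filter, mem_univ, true_and]
      refine and_congr_right fun hji => ?_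
      subst hji
      by_cases hj : j = s (col j)
      · rw [hj, hFs, hz]
        simp only [hcs, ε, if_pos hai]
        constructor <;> intro <;> linarith
      · exact hpos _ _ (hFn j hj)
    · have : a i = P i + 1 := by have := ha i; omega
      rw [this, ← Finset.card_insert_of_notMem hsn]
      congr 1
      ext j
      simp only [mem_filter, mem_univ, true_and, mem_insert]
      constructor
      · rintro ⟨rfl, h⟩
        by_cases hj : j = s (col j)
        · exact Or.inl hj
        · exact Or.inr ⟨rfl, (hpos _ _ (hFn j hj)).1 h⟩
      · rintro (rfl | ⟨rfl, h⟩)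
        · refine ⟨hcs i, ?_⟩
          rw [hFs]; simp only [ε, if_neg hai]; linarith
        · refine ⟨rfl, ?_⟩
          have hj : j ≠ s (col j) := by
            intro hj; rw [hj, hz] at h; exact lt_irrefl _ h
          exact (hpos _ _ (hFn j hj)).2 h

end
end HS
namespace HS
open Finset

/-- homogenization -/
noncomputable def hom {d : ℕ} (p : EuclideanSpace ℝ (Fin d)) : Fin (d+1) → ℝ :=
  Fin.cons 1 (fun l => p l)

lemma hom_apply {d : ℕ} (F : (Fin (d+1) → ℝ) →ₗ[ℝ] ℝ) (p : EuclideanSpace ℝ (Fin d)) :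
    F (hom p) = ⟪p, (WithLp.toLp 2 (fun l : Fin d => F (Pi.single l.succ 1)) :
      EuclideanSpace ℝ (Fin d))⟫ - (- F (Pi.single 0 1)) := by
  rw [F.pi_apply_eq_sum_univ (hom p), Fin.sum_univ_succ, PiLp.inner_apply]
  have e : ∀ i : Fin (d+1), (fun j => if i = j then (1:ℝ) else 0) = Pi.single i 1 := by
    intro i; ext j; simp [Pi.single_apply, eq_comm]
  simp only [e, hom, Fin.cons_zero, Fin.cons_succ, smul_eq_mul]
  simp [mul_comm]
  ring

lemma hom_gen {d : ℕ} (Y : Finset (EuclideanSpace ℝ (Fin d))) (hgp : GenPos d Y) :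
    Gen univ (fun j : Y => hom j.1) := by
  intro e he _ h0
  obtain ⟨w, hw0, hw⟩ := Matrix.exists_vecMul_eq_zero_iff.2 h0
  have hinj : Function.Injective (fun k => (e k).1) := fun a b h => he (Subtype.ext h)
  have haff : AffineIndependent ℝ (fun k => (e k).1) := by
    let T : Finset (EuclideanSpace ℝ (Fin d)) := univ.image (fun k => (e k).1)
    have h1 := hgp T (by
      intro x hx
      obtain ⟨k, _, rfl⟩ := mem_image.1 hx
      exact (e k).2) (by
      refine Finset.card_image_le.trans ?_
      simp)
    let f : Fin (d+1) ↪ T := ⟨fun k => ⟨(e k).1, mem_image_of_mem _ (mem_univ k)⟩, by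
      intro a b h; exact hinj (Subtype.mk.inj h)⟩
    exact h1.comp_embedding f
  rw [affineIndependent_iff] at haff
  have hcomp : ∀ l, ∑ k, w k * hom (e k).1 l = 0 := by
    intro l
    have := congrFun hw l
    simpa [Matrix.vecMul, dotProduct] using this
  apply hw0
  ext k
  refine haff univ w ?_ ?_ k (mem_univ k)
  · simpa [hom] using hcomp 0
  · ext l
    simpa [hom] using hcomp l.succ

end HS

theorem special_discrete_ham_sandwich
    (d n : ℕ) (hd : 2 ≤ d) (hn : 2 ≤ n)
    (X : Fin d → Finset (EuclideanSpace ℝ (Fin d)))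
    (hdisj : ∀ i j : Fin d, i ≠ j → Disjoint (X i) (X j))
    (hgp : GenPos d (Finset.univ.biUnion X))
    (hbal : ∀ i : Fin d, (d + 1) * (X i).card ≥ ∑ j : Fin d, (X j).card)
    (hcard : ∑ i : Fin d, (X i).card = (d + 1) * n) :
    ∃ (v : EuclideanSpace ℝ (Fin d)) (c : ℝ), v ≠ 0 ∧
      (∀ i : Fin d, ∀ p ∈ X i, ⟪p, v⟫ ≠ c) ∧
      -- balanced in the open halfspace above, with point count a positive multiple of d+1
      (∀ i : Fin d, (d + 1) * ((X i).filter (fun p => c < ⟪p, v⟫)).card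
          ≥ ∑ j : Fin d, ((X j).filter (fun p => c < ⟪p, v⟫)).card) ∧
      (∃ q : ℕ, 1 ≤ q ∧
        ∑ j : Fin d, ((X j).filter (fun p => c < ⟪p, v⟫)).card = (d + 1) * q) ∧
      -- balanced in the open halfspace below, with point count a positive multiple of d+1
      (∀ i : Fin d, (d + 1) * ((X i).filter (fun p => ⟪p, v⟫ < c)).card
          ≥ ∑ j : Fin d, ((X j).filter (fun p => ⟪p, v⟫ < c)).card) ∧
      (∃ q : ℕ, 1 ≤ q ∧
        ∑ j : Fin d, ((X j).filter (fun p => ⟪p, v⟫ < c)).card = (d + 1) * q) := by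
  classical
  have hcol : ∀ j : (Finset.univ.biUnion X : Finset _), ∃ i, j.1 ∈ X i := by
    intro j
    obtain ⟨i, _, hi⟩ := Finset.mem_biUnion.1 j.2
    exact ⟨i, hi⟩
  choose col hcol using hcol
  have hcol_iff : ∀ j i, col j = i ↔ j.1 ∈ X i := by
    intro j i
    constructor
    · rintro rfl; exact hcol j
    · intro h
      by_contra hne
      exact Finset.disjoint_left.1 (hdisj _ _ hne) (hcol j) h
  have hcount : ∀ (i : Fin d) (Q : EuclideanSpace ℝ (Fin d) → Prop),
      (Finset.univ.filter (fun j : (Finset.univ.biUnion X : Finset _) => col j = i ∧ Q j.1)).card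
        = ((X i).filter Q).card := by
    intro i Q
    refine Finset.card_bij (fun j _ => j.1) ?_ ?_ ?_
    · intro j hj
      simp only [Finset.mem_filter, Finset.mem_univ, true_and] at hj ⊢
      exact ⟨(hcol_iff j i).1 hj.1, hj.2⟩
    · intro a _ b _ h; exact Subtype.ext h
    · intro p hp
      rw [Finset.mem_filter] at hp
      refine ⟨⟨p, Finset.mem_biUnion.2 ⟨i, Finset.mem_univ _, hp.1⟩⟩, ?_, rfl⟩
      simp only [Finset.mem_filter, Finset.mem_univ, true_and]
      exact ⟨(hcol_iff _ i).2 hp.1, hp.2⟩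
  have hm : ∀ i, n ≤ (X i).card := by
    intro i
    have := hbal i
    rw [hcard] at this
    exact Nat.le_of_mul_le_mul_left this (by omega)
  obtain ⟨F, hF0, k, a, hk1, hk2, ha, hab, hsa⟩ := HS.core n hn
    (fun j : (Finset.univ.biUnion X : Finset _) => HS.hom j.1) col (HS.hom_gen _ hgp)
    (fun i => (X i).card) (by
      intro i
      have := hcount i (fun _ => True)
      simpa using this) hm hcard
  set v : EuclideanSpace ℝ (Fin d) := WithLp.toLp 2 (fun l : Fin d => F (Pi.single l.succ 1)) with hv
  set c : ℝ := - F (Pi.single 0 1) with hc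
  have hFv : ∀ p, F (HS.hom p) = ⟪p, v⟫ - c := fun p => HS.hom_apply F p
  have hne : ∀ i : Fin d, ∀ p ∈ X i, ⟪p, v⟫ ≠ c := by
    intro i p hp h
    have := hF0 ⟨p, Finset.mem_biUnion.2 ⟨i, Finset.mem_univ _, hp⟩⟩
    rw [hFv, h] at this
    simp at this
  have hup : ∀ i, ((X i).filter (fun p => c < ⟪p, v⟫)).card = a i := by
    intro i
    rw [← ha i, ← hcount i]
    simp only [hFv, sub_pos]
  have hlow : ∀ i, ((X i).filter (fun p => ⟪p, v⟫ < c)).card + a i = (X i).card := by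
    intro i
    rw [← hup i, ← Finset.card_union_of_disjoint, ← Finset.filter_or]
    · congr 1
      apply Finset.filter_true_of_mem
      intro p hp
      exact lt_or_gt_of_ne (hne i p hp)
    · rw [Finset.disjoint_left]
      intro p h1 h2
      have h1 := (Finset.mem_filter.1 h1).2
      have h2 := (Finset.mem_filter.1 h2).2
      linarith
  have hsl : ∑ i, ((X i).filter (fun p => ⟪p, v⟫ < c)).card = (d+1) * (n - k) := by
    have h1 : ∑ i, (((X i).filter (fun p => ⟪p, v⟫ < c)).card + a i) = (d+1) * n := by
      rw [← hcard]; exact Finset.sum_congr rfl fun i _ => hlow i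
    rw [Finset.sum_add_distrib, hsa] at h1
    rw [Nat.mul_sub]
    omega
  have hsu : ∑ i, ((X i).filter (fun p => c < ⟪p, v⟫)).card = (d+1) * k := by
    rw [← hsa]; exact Finset.sum_congr rfl fun i _ => hup i
  refine ⟨v, c, ?_, hne, ?_, ⟨k, hk1, hsu⟩, ?_, ⟨n - k, by omega, hsl⟩⟩
  · intro h0
    have i : Fin d := ⟨0, by omega⟩
    have h1 : 0 < ((X i).filter (fun p => c < ⟪p, v⟫)).card := by
      rw [hup]; have := hab i; omega
    have h2 : 0 < ((X i).filter (fun p => ⟪p, v⟫ < c)).card := by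
      have := hlow i; have := hab i; omega
    obtain ⟨p, hp⟩ := Finset.card_pos.1 h1
    obtain ⟨q, hq⟩ := Finset.card_pos.1 h2
    have hp := (Finset.mem_filter.1 hp).2
    have hq := (Finset.mem_filter.1 hq).2
    rw [h0, inner_zero_right] at hp hq
    linarith
  · intro i
    rw [hsu, hup]
    exact Nat.mul_le_mul_left _ (hab i).1
  · intro i
    rw [hsl]
    apply Nat.mul_le_mul_left
    have := hlow i; have := hab i; omega
end
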